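/- Let k be an algebraic extension of 𝔽_p and let Γ be a subgroup of ℚ with ℤ ⊆ Γ ⊆ ℚ, such that either [k:𝔽_p] is infinite or [Γ:ℤ] is infinite. Then there exists α ∈ ℂ_p, transcendental over ℚ_p (α ∉ Q̄_p), such that the residue field k_α of O_{p,α} is isomorphic to k and its value group Γ_α equals Γ; consequently the valuation ring ℤ_{p,α} of ℚ_p(X) has residue field k and value group Γ. -/

import Mathlib

open Polynomial Filter

noncomputable section

/-- An additive `ℚ`-valued valuation on a field `K` (written additively, with `v 0 = ⊤`). -/
structure AddVal (K : Type) [Field K] where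
  v : K → WithTop ℚ
  v_eq_top_iff : ∀ x : K, v x = ⊤ ↔ x = 0
  v_mul : ∀ x y : K, v (x * y) = v x + v y
  min_le_v_add : ∀ x y : K, min (v x) (v y) ≤ v (x + y)

namespace AddVal

variable {K : Type} [Field K] (w : AddVal K)

/-- A Cauchy sequence with respect to an additive valuation. -/
def IsCauchySeq (s : ℕ → K) : Prop :=
  ∀ γ : ℚ, ∃ N : ℕ, ∀ m ≥ N, ∀ n ≥ N, (γ : WithTop ℚ) < w.v (s m - s n)

/-- Convergence of a sequence to a limit, with respect to an additive valuation. -/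
def TendsToVal (s : ℕ → K) (l : K) : Prop :=
  ∀ γ : ℚ, ∃ N : ℕ, ∀ n ≥ N, (γ : WithTop ℚ) < w.v (s n - l)

/-- A pseudo-convergent sequence: `v (s n - s m) < v (s m - s k)` for `n < m < k`. -/
def IsPseudoConvergent (s : ℕ → K) : Prop :=
  ∀ ⦃n m k : ℕ⦄, n < m → m < k → w.v (s n - s m) < w.v (s m - s k)

/-- A sequence is of transcendental type over a subring (mapped in via `g`) if for every
polynomial `f` over that ring the sequence `v (f (s n))` is eventually constant. -/
def IsTranscendentalTypeOver {R : Type} [CommRing R] (g : R →+* K) (s : ℕ → K) : Prop :=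
  ∀ f : Polynomial R, ∃ N : ℕ, ∀ m ≥ N, ∀ n ≥ N,
    w.v (f.eval₂ g (s m)) = w.v (f.eval₂ g (s n))

/-- A sequence of transcendental type: for every polynomial `f ∈ K[X]`, `v (f (s n))` is
eventually constant. -/
def IsTranscendentalType (s : ℕ → K) : Prop :=
  w.IsTranscendentalTypeOver (RingHom.id K) s

/-- `α` is a pseudo-limit of `s` when `v (s n - α)` is strictly increasing. -/
def IsPseudoLimit (s : ℕ → K) (α : K) : Prop :=
  StrictMono fun n => w.v (s n - α)

/-- The breadth ideal of a pseudo-convergent sequence. -/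
def breadth (s : ℕ → K) : Set K :=
  {x : K | ∀ n : ℕ, w.v (s (n + 1) - s n) < w.v x}

/-- Equivalence of pseudo-convergent sequences. -/
def SeqEquiv (s t : ℕ → K) : Prop :=
  w.breadth s = w.breadth t ∧
    ∀ k : ℕ, ∃ i₀ j₀ : ℕ, ∀ i ≥ i₀, ∀ j ≥ j₀, w.v (s (k + 1) - s k) < w.v (s i - t j)

end AddVal

/-- `α` is transcendental over the image of `g`. -/
def IsTranscOver {R K : Type} [CommRing R] [Field K] (g : R →+* K) (α : K) : Prop :=
  ∀ f : Polynomial R, f ≠ 0 → f.eval₂ g α ≠ 0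
/-- A fixed algebraic closure of `ℚ_p`. -/
abbrev Qpbar (p : ℕ) [Fact p.Prime] : Type := AlgebraicClosure ℚ_[p]

/-- The unique extension of the `p`-adic valuation to the algebraic closure of `ℚ_p`,
presented as an additive `ℚ`-valued valuation extending `Padic.valuation`. -/
structure PadicSetup (p : ℕ) [Fact p.Prime] where
  vbar : AddVal (Qpbar p)
  vbar_extends : ∀ x : ℚ_[p], x ≠ 0 →
    vbar.v (algebraMap ℚ_[p] (Qpbar p) x) = ((x.valuation : ℚ) : WithTop ℚ)

/-- A model of `ℂ_p`: a complete valued field in which `Q̄_p` embeds isometrically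
and densely. -/
structure CpSetup (p : ℕ) [Fact p.Prime] extends PadicSetup p where
  Cp : Type
  [fieldCp : Field Cp]
  emb : Qpbar p →+* Cp
  vC : AddVal Cp
  vC_emb : ∀ x : Qpbar p, vC.v (emb x) = vbar.v x
  complete : ∀ s : ℕ → Cp, vC.IsCauchySeq s → ∃ l : Cp, vC.TendsToVal s l
  dense : ∀ y : Cp, ∃ s : ℕ → Qpbar p, vC.TendsToVal (fun n => emb (s n)) y

attribute [instance] CpSetup.fieldCp

variable (p : ℕ) [Fact p.Prime]

/-- The degree `[ℚ_p(x) : ℚ_p]` of an element of the algebraic closure of `ℚ_p`. -/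
def degOf (x : Qpbar p) : ℕ :=
  Module.finrank ℚ_[p] ↥(IntermediateField.adjoin ℚ_[p] {x})

/-- A stacked sequence in `Q̄_p`: `s 0 ∈ ℚ_p`, the degrees `[ℚ_p(s n) : ℚ_p]` are strictly
increasing, and each `(s n, v (s (n+1) - s n))` is a minimal pair. -/
structure IsStacked (S : PadicSetup p) (s : ℕ → Qpbar p) : Prop where
  first : ∃ c : ℚ_[p], s 0 = algebraMap ℚ_[p] (Qpbar p) c
  deg_lt : ∀ n : ℕ, degOf p (s n) < degOf p (s (n + 1))
  min_pair : ∀ n : ℕ, ∀ c : Qpbar p, degOf p c < degOf p (s n) →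
    S.vbar.v (s n - c) < S.vbar.v (s (n + 1) - s n)

/-- A strongly stacked sequence: moreover each pair `(s n, s (n+1))` is distinguished. -/
structure IsStronglyStacked (S : PadicSetup p) (s : ℕ → Qpbar p) extends
    IsStacked p S s : Prop where
  dist : ∀ n : ℕ, ∀ c : Qpbar p, degOf p c < degOf p (s (n + 1)) →
    S.vbar.v (s (n + 1) - c) ≤ S.vbar.v (s (n + 1) - s n)

/-- The canonical map `ℚ → Q̄_p`. -/
def qHomQpbar : ℚ →+* Qpbar p :=
  (algebraMap ℚ_[p] (Qpbar p)).comp (Rat.castHom ℚ_[p])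

/-- The ring `ℤ_{p,E}` (as a subset of `ℚ_p(X)`) attached to a sequence `E ⊆ Q̄_p`:
rational functions mapping almost all the `s n` into `Z̄_p`. -/
def ZpE (S : PadicSetup p) (s : ℕ → Qpbar p) : Set (RatFunc ℚ_[p]) :=
  {φ : RatFunc ℚ_[p] | ∀ᶠ n in atTop,
    φ.denom.eval₂ (algebraMap ℚ_[p] (Qpbar p)) (s n) ≠ 0 ∧
      0 ≤ S.vbar.v (φ.eval (algebraMap ℚ_[p] (Qpbar p)) (s n))}

/-- The ring `ℤ_{(p),E}` (as a subset of `ℚ(X)`) attached to a sequence `E ⊆ Q̄_p`. -/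
def ZplE (S : PadicSetup p) (s : ℕ → Qpbar p) : Set (RatFunc ℚ) :=
  {φ : RatFunc ℚ | ∀ᶠ n in atTop,
    φ.denom.eval₂ (qHomQpbar p) (s n) ≠ 0 ∧
      0 ≤ S.vbar.v (φ.eval (qHomQpbar p) (s n))}

/-- `W` is a residually algebraic torsion extension of `ℤ_p` to `ℚ_p(X)`:
`W ∩ ℚ_p = ℤ_p`, the residue field of `W` is algebraic over `𝔽_p`, and the value group of `W`
is contained in the divisible hull of the value group of `ℤ_p`. -/
def IsResAlgTorsionQp (W : ValuationSubring (RatFunc ℚ_[p])) : Prop :=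
  (∀ c : ℚ_[p], RatFunc.C c ∈ W ↔ ‖c‖ ≤ 1) ∧
  (∀ x : IsLocalRing.ResidueField W, ∃ k : ℕ, 1 ≤ k ∧ x ^ p ^ k = x) ∧
  (∀ φ : RatFunc ℚ_[p], φ ≠ 0 → ∃ n : ℕ, 1 ≤ n ∧ ∃ c : ℚ_[p], c ≠ 0 ∧
    φ ^ n / RatFunc.C c ∈ W ∧ RatFunc.C c / φ ^ n ∈ W)

/-- `W` is a residually algebraic torsion extension of `ℤ_(p)` to `ℚ(X)`. -/
def IsResAlgTorsionQ (W : ValuationSubring (RatFunc ℚ)) : Prop :=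
  (∀ c : ℚ, RatFunc.C c ∈ W ↔ ‖(c : ℚ_[p])‖ ≤ 1) ∧
  (∀ x : IsLocalRing.ResidueField W, ∃ k : ℕ, 1 ≤ k ∧ x ^ p ^ k = x) ∧
  (∀ φ : RatFunc ℚ, φ ≠ 0 → ∃ n : ℕ, 1 ≤ n ∧ ∃ c : ℚ, c ≠ 0 ∧
    φ ^ n / RatFunc.C c ∈ W ∧ RatFunc.C c / φ ^ n ∈ W)

/-- The set of (rational) values of the valuation on an intermediate field of `Q̄_p/ℚ_p`. -/
def valSetF (S : PadicSetup p) (F : IntermediateField ℚ_[p] (Qpbar p)) : Set ℚ :=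
  {γ : ℚ | ∃ a ∈ F, S.vbar.v a = (γ : WithTop ℚ)}

/-- The value group (as a set of rationals) of `ℚ_p(x)` for `x ∈ Q̄_p`. -/
def valSetElem (S : PadicSetup p) (x : Qpbar p) : Set ℚ :=
  valSetF p S (IntermediateField.adjoin ℚ_[p] {x})

/-- The residue field of `F` is contained in the residue field of `F'` (inside the residue
field of `Z̄_p`). -/
def resSub (S : PadicSetup p) (F F' : IntermediateField ℚ_[p] (Qpbar p)) : Prop :=
  ∀ a ∈ F, 0 ≤ S.vbar.v a → ∃ b ∈ F', 0 ≤ S.vbar.v b ∧ 0 < S.vbar.v (a - b)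

/-- A subset `Γ ⊆ ℚ` (a value group) has bounded denominators, i.e. finite ramification
over `ℤ`. -/
def HasFiniteRamification (Γ : Set ℚ) : Prop :=
  ∃ e : ℕ, 0 < e ∧ ∀ γ ∈ Γ, ∃ k : ℤ, (e : ℚ) * γ = (k : ℚ)

/-- The ramification index of `Γ₁` over `Γ₀`: the least positive integer `e` with
`e • Γ₁ ⊆ Γ₀` (for the value groups of finite extensions of `ℚ_p` this is the index
`[Γ₁ : Γ₀]`). -/
def ramIdx (Γ₀ Γ₁ : Set ℚ) : ℕ :=
  sInf {e : ℕ | 0 < e ∧ ∀ γ ∈ Γ₁, (e : ℚ) * γ ∈ Γ₀}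

/-- The value group of `ℚ_p` (normalized): the integers, as a subset of `ℚ`. -/
def zSet : Set ℚ := Set.range ((↑) : ℤ → ℚ)

/-- The maximal unramified extension of a finite extension `K` of `ℚ_p` inside `Q̄_p`:
the set of `x` with `K(x)/K` unramified. -/
def maxUnramified (S : PadicSetup p) (K : IntermediateField ℚ_[p] (Qpbar p)) :
    Set (Qpbar p) :=
  {x : Qpbar p | valSetF p S (K ⊔ IntermediateField.adjoin ℚ_[p] {x}) = valSetF p S K}

section CpDefs

variable (S : CpSetup p)

/-- The canonical map `ℚ_p → ℂ_p`. -/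
def qpHomC : ℚ_[p] →+* S.Cp :=
  S.emb.comp (algebraMap ℚ_[p] (Qpbar p))

/-- The canonical map `ℚ → ℂ_p`. -/
def qHomC : ℚ →+* S.Cp :=
  (qpHomC p S).comp (Rat.castHom ℚ_[p])

/-- The valuation domain `ℤ_{p,α} = {φ ∈ ℚ_p(X) : φ(α) ∈ O_p}` (as a subset of `ℚ_p(X)`). -/
def Zpa (α : S.Cp) : Set (RatFunc ℚ_[p]) :=
  {φ : RatFunc ℚ_[p] | φ.denom.eval₂ (qpHomC p S) α ≠ 0 ∧
    0 ≤ S.vC.v (φ.eval (qpHomC p S) α)}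

/-- The valuation domain `ℤ_{(p),α} = {φ ∈ ℚ(X) : φ(α) ∈ O_p}` (as a subset of `ℚ(X)`). -/
def Zpla (α : S.Cp) : Set (RatFunc ℚ) :=
  {φ : RatFunc ℚ | φ.denom.eval₂ (qHomC p S) α ≠ 0 ∧
    0 ≤ S.vC.v (φ.eval (qHomC p S) α)}

/-- Membership in the subfield `ℚ_p(α)` of `ℂ_p`. -/
def InQpAlpha (α x : S.Cp) : Prop :=
  ∃ f g : Polynomial ℚ_[p], g.eval₂ (qpHomC p S) α ≠ 0 ∧
    x = f.eval₂ (qpHomC p S) α / g.eval₂ (qpHomC p S) α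

/-- The value group `Γ_α ⊆ ℚ` of `ℚ_p(α) ⊆ ℂ_p`. -/
def valSetCp (α : S.Cp) : Set ℚ :=
  {γ : ℚ | ∃ x : S.Cp, InQpAlpha p S α x ∧ S.vC.v x = (γ : WithTop ℚ)}

/-- The residue field `k_α` of `O_{p,α} = O_p ∩ ℚ_p(α)` is finite. -/
def ResFieldFiniteCp (α : S.Cp) : Prop :=
  ∃ T : Finset S.Cp, ∀ x : S.Cp, InQpAlpha p S α x → 0 ≤ S.vC.v x →
    ∃ a ∈ T, 0 < S.vC.v (x - a)

/-- `α` and `β` are conjugate over `ℚ_p`: some element of `Gal(Q̄_p/ℚ_p)`, extended to its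
unique continuous (equivalently, isometric) automorphism of `ℂ_p`, maps `α` to `β`. -/
def ConjCp (α β : S.Cp) : Prop :=
  ∃ σ : S.Cp →+* S.Cp, (∀ c : ℚ_[p], σ (qpHomC p S c) = qpHomC p S c) ∧
    (∀ x : Qpbar p, ∃ y : Qpbar p, σ (S.emb x) = S.emb y) ∧
    (∀ x : S.Cp, S.vC.v (σ x) = S.vC.v x) ∧ σ α = β

end CpDefs



/-- The field `k` (of characteristic `p`) contains an element of degree exactly `d` over
`𝔽_p`; for algebraic extensions of `𝔽_p` this holds iff `𝔽_{p^d} ⊆ k`, and by Steinitz's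
classification two algebraic extensions of `𝔽_p` are isomorphic iff they contain elements of
exactly the same degrees. -/
def FieldHasDeg (p d : ℕ) (k : Type) [Field k] : Prop :=
  ∃ x : k, x ^ p ^ d = x ∧ ∀ e : ℕ, 1 ≤ e → e < d → x ^ p ^ e ≠ x

/-- The residue field `k_α` of `O_{p,α} = O_p ∩ ℚ_p(α)` contains an element of degree
exactly `d` over `𝔽_p`. -/
def ResHasDegCp (p : ℕ) [Fact p.Prime] (S : CpSetup p) (α : S.Cp) (d : ℕ) : Prop :=
  ∃ x : S.Cp, InQpAlpha p S α x ∧ 0 ≤ S.vC.v x ∧ 0 < S.vC.v (x ^ p ^ d - x) ∧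
    ∀ e : ℕ, 1 ≤ e → e < d → ¬ 0 < S.vC.v (x ^ p ^ e - x)

/-- The residue field of the valuation ring `ℤ_{p,α}` of `ℚ_p(X)` contains an element of
degree exactly `d` over `𝔽_p`. -/
def ZpaResHasDeg (p : ℕ) [Fact p.Prime] (S : CpSetup p) (α : S.Cp) (d : ℕ) : Prop :=
  ∃ φ ∈ Zpa p S α,
    0 < S.vC.v ((RatFunc.eval (qpHomC p S) α φ) ^ p ^ d - RatFunc.eval (qpHomC p S) α φ) ∧
    ∀ e : ℕ, 1 ≤ e → e < d →
      ¬ 0 < S.vC.v ((RatFunc.eval (qpHomC p S) α φ) ^ p ^ e - RatFunc.eval (qpHomC p S) α φ)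

section PrimeNorm

variable {p : ℕ} [Fact p.Prime] {C : Type*} [NormedField C]

lemma norm_eq_one_of_pow_eq_one {d : ℕ} (hd : d ≠ 0) {x : C} (hx : x ^ (p ^ d - 1) = 1) :
    ‖x‖ = 1 := by
  have hq : 2 ≤ p ^ d := (Fact.out : p.Prime).two_le.trans (Nat.le_self_pow hd p)
  have := congrArg norm hx
  rwa [norm_pow, norm_one, pow_eq_one_iff_of_nonneg (norm_nonneg _) (by omega)] at this

variable [NormedAlgebra ℚ_[p] C]

lemma norm_natCast_prime : ‖(p : C)‖ = (p : ℝ)⁻¹ := by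
  rw [← map_natCast (algebraMap ℚ_[p] C), norm_algebraMap', Padic.norm_p]

lemma norm_of_pow_eq_prime {π : C} {e : ℕ} (he : 1 ≤ e) (h : π ^ e = (p : C)) :
    ‖π‖ = (p : ℝ) ^ (-(1 / e) : ℝ) := by
  have he' : e ≠ 0 := by omega
  have hp : (0 : ℝ) < p := by exact_mod_cast (Fact.out : p.Prime).pos
  refine (pow_left_inj₀ (norm_nonneg _) (by positivity) he').1 ?_
  rw [← norm_pow, h, norm_natCast_prime (p := p), ← Real.rpow_natCast, ← Real.rpow_mul hp.le,
    ← Real.rpow_neg_one]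
  congr 1
  field_simp

end PrimeNorm

section NormedResidue

variable {p : ℕ} [Fact p.Prime] {C : Type*} [NormedField C] [IsUltrametricDist C]

variable (C) in
/-- The valuation ring of an ultrametric normed field. -/
abbrev unitBallRing : ValuationSubring C := (NormedField.valuation (K := C)).valuationSubring

variable (C) in
/-- The residue field of an ultrametric normed field. -/
abbrev NormResidueField : Type _ := IsLocalRing.ResidueField (unitBallRing C)

/-- Reduction from the valuation ring to the residue field. -/
abbrev normResidue : unitBallRing C →+* NormResidueField C := IsLocalRing.residue _

lemma mem_unitBallRing {x : C} : x ∈ unitBallRing C ↔ ‖x‖ ≤ 1 := by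
  rw [Valuation.mem_valuationSubring_iff, NormedField.valuation_apply, ← NNReal.coe_le_coe]; simp

lemma normResidue_eq_zero {x : unitBallRing C} : normResidue x = 0 ↔ ‖(x : C)‖ < 1 := by
  rw [IsLocalRing.residue_eq_zero_iff, IsLocalRing.mem_maximalIdeal, mem_nonunits_iff]
  have hx : ‖(x : C)‖ ≤ 1 := mem_unitBallRing.1 x.2
  constructor
  · intro h
    refine lt_of_le_of_ne hx fun h1 => h ?_
    have hx0 : (x : C) ≠ 0 := norm_ne_zero_iff.1 (by rw [h1]; exact one_ne_zero)
    refine IsUnit.of_mul_eq_one ⟨(x : C)⁻¹, mem_unitBallRing.2 (by rw [norm_inv, h1, inv_one])⟩ ?_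
    exact Subtype.ext (mul_inv_cancel₀ hx0)
  · intro h hu
    obtain ⟨y, hy⟩ := hu.exists_right_inv
    have h1 : ‖(x : C)‖ * ‖(y : C)‖ = 1 := by
      rw [← norm_mul, ← norm_one (α := C)]; exact congrArg (fun z : unitBallRing C => ‖(z : C)‖) hy
    have hy1 : ‖(y : C)‖ ≤ 1 := mem_unitBallRing.1 y.2
    nlinarith [norm_nonneg (y : C), norm_nonneg (x : C)]

lemma normResidue_eq_iff {x y : unitBallRing C} :
    normResidue x = normResidue y ↔ ‖(x : C) - y‖ < 1 := by
  rw [← sub_eq_zero, ← map_sub, normResidue_eq_zero]; rfl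

variable [NormedAlgebra ℚ_[p] C]

variable (p C) in
lemma normResidueField_charP : CharP (NormResidueField C) p := by
  refine (CharP.charP_iff_prime_eq_zero Fact.out).2 ?_
  rw [← map_natCast (normResidue (C := C)), normResidue_eq_zero]
  exact (norm_natCast_prime (C := C)).trans_lt
    (inv_lt_one_of_one_lt₀ (by exact_mod_cast (Fact.out : p.Prime).one_lt))

instance normResidueField_algebra : Algebra (ZMod p) (NormResidueField C) :=
  haveI := normResidueField_charP p C
  ZMod.algebra _ p

variable (p C) in
/-- The map from `ℤ_[p]` to the valuation ring of a normed extension of `ℚ_[p]`. -/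
def padicIntToUnitBall : ℤ_[p] →+* unitBallRing C :=
  ((algebraMap ℚ_[p] C).comp PadicInt.Coe.ringHom).codRestrict (unitBallRing C) fun x => by
    rw [mem_unitBallRing]
    exact (norm_algebraMap' C (x : ℚ_[p])).trans_le x.norm_le_one

lemma coe_padicIntToUnitBall (x : ℤ_[p]) :
    (padicIntToUnitBall p C x : C) = algebraMap ℚ_[p] C x := rfl

lemma normResidue_padicInt (x : ℤ_[p]) :
    normResidue (padicIntToUnitBall p C x) =
      algebraMap (ZMod p) (NormResidueField C) (PadicInt.toZMod x) := by
  have h := PadicInt.toZMod_spec x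
  rw [IsLocalRing.mem_maximalIdeal, PadicInt.mem_nonunits] at h
  have h2 : ((PadicInt.toZMod x).cast : ℤ_[p]) = ((PadicInt.toZMod x).val : ℤ_[p]) := by
    rw [ZMod.natCast_val]
  rw [h2] at h
  have h3 : normResidue (padicIntToUnitBall p C x) =
      normResidue (padicIntToUnitBall p C ((PadicInt.toZMod x).val : ℤ_[p])) := by
    rw [normResidue_eq_iff, coe_padicIntToUnitBall, coe_padicIntToUnitBall, ← map_sub,
      norm_algebraMap']
    exact_mod_cast h
  rw [h3, map_natCast, map_natCast]
  conv_rhs => rw [← ZMod.natCast_zmod_val (PadicInt.toZMod x)]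
  rw [map_natCast]

lemma coe_eval₂_padicInt (h : ℤ_[p][X]) (x : unitBallRing C) :
    ((h.eval₂ (padicIntToUnitBall p C) x : unitBallRing C) : C) =
      aeval (x : C) (h.map PadicInt.Coe.ringHom) := by
  have := hom_eval₂ h (padicIntToUnitBall p C) (unitBallRing C).subtype x
  rw [aeval_def, eval₂_map]
  exact this

lemma normResidue_eval₂_padicInt (h : ℤ_[p][X]) (x : unitBallRing C) :
    normResidue (h.eval₂ (padicIntToUnitBall p C) x) =
      aeval (normResidue x) (h.map (PadicInt.toZMod (p := p))) := by
  rw [hom_eval₂, aeval_def, eval₂_map]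
  congr 1
  ext y
  exact normResidue_padicInt y

/-- A polynomial over `ℚ_[p]` with coefficients of norm at most one lifts to `ℤ_[p]`. -/
lemma exists_padicInt_lift {g : ℚ_[p][X]} (hg : ∀ i, ‖g.coeff i‖ ≤ 1) :
    ∃ h : ℤ_[p][X], h.map PadicInt.Coe.ringHom = g := by
  rw [← Polynomial.mem_lifts, Polynomial.lifts_iff_coeff_lifts]
  exact fun n => ⟨⟨g.coeff n, hg n⟩, rfl⟩

lemma padicInt_coe_injective : Function.Injective (PadicInt.Coe.ringHom (p := p)) :=
  Subtype.coe_injective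

/-- If the degree of `g` is less than the degree of the residue of `x` then the norm of `g(x)` is
the maximum of the norms of the coefficients of `g`. -/
lemma exists_norm_aeval_eq_norm_coeff {x : unitBallRing C} {g : ℚ_[p][X]}
    (hg : g.natDegree < (minpoly (ZMod p) (normResidue x)).natDegree) :
    ∃ i, ‖aeval (x : C) g‖ = ‖g.coeff i‖ ∧ ∀ j, ‖g.coeff j‖ ≤ ‖aeval (x : C) g‖ := by
  obtain ⟨i, hi, hmax⟩ := Finset.exists_max_image (Finset.range (g.natDegree + 1))
    (fun i => ‖g.coeff i‖) ⟨0, by simp⟩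
  have hmax' : ∀ j, ‖g.coeff j‖ ≤ ‖g.coeff i‖ := by
    intro j
    by_cases hj : j < g.natDegree + 1
    · exact hmax j (by simpa using hj)
    · rw [coeff_eq_zero_of_natDegree_lt (by omega), norm_zero]; exact norm_nonneg _
  refine ⟨i, ?_⟩
  suffices h : ‖aeval (x : C) g‖ = ‖g.coeff i‖ from ⟨h, fun j => (hmax' j).trans h.ge⟩
  set c := g.coeff i with hc
  by_cases hc0 : c = 0
  · have : g = 0 := by
      ext j
      have := hmax' j
      rw [hc0, norm_zero] at this
      simpa using this
    rw [this, hc0]; simp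
  obtain ⟨h, hh⟩ := exists_padicInt_lift (p := p) (g := Polynomial.C c⁻¹ * g) (by
    intro j
    rw [coeff_C_mul, norm_mul, norm_inv, inv_mul_le_one₀ (norm_pos_iff.2 hc0)]
    exact hmax' j)
  have hg' : g = Polynomial.C c * h.map PadicInt.Coe.ringHom := by
    rw [hh, ← mul_assoc, ← C_mul, mul_inv_cancel₀ hc0, C_1, one_mul]
  have hone : ‖aeval (x : C) (h.map PadicInt.Coe.ringHom)‖ = 1 := by
    rw [← coe_eval₂_padicInt]
    refine le_antisymm (mem_unitBallRing.1 (Subtype.prop _)) (not_lt.1 fun hlt => ?_)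
    rw [← normResidue_eq_zero, normResidue_eval₂_padicInt] at hlt
    have hne : h.map (PadicInt.toZMod (p := p)) ≠ 0 := by
      intro h0
      have hcoeff : PadicInt.toZMod (h.coeff i) = 0 := by
        rw [← coeff_map, h0, coeff_zero]
      have h1 : (h.coeff i : ℚ_[p]) = 1 := by
        have := congrArg (fun f => f.coeff i) hh
        simp only [coeff_map, coeff_C_mul] at this
        rw [← hc, inv_mul_cancel₀ hc0] at this
        exact this
      have h2 : h.coeff i = 1 := Subtype.ext h1
      rw [h2, map_one] at hcoeff
      exact one_ne_zero hcoeff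
    have hle := natDegree_le_natDegree
      (minpoly.degree_le_of_ne_zero (ZMod p) (normResidue x) hne hlt)
    have h3 : (h.map (PadicInt.toZMod (p := p))).natDegree ≤ g.natDegree := by
      refine natDegree_map_le.trans ?_
      rw [← natDegree_map_eq_of_injective padicInt_coe_injective h, hh]
      exact natDegree_C_mul_le _ _
    omega
  conv_lhs => rw [hg']
  rw [map_mul, aeval_C, norm_mul, hone, mul_one, norm_algebraMap']

/-- The residue of an integral algebraic element has degree at most that of the element. -/
lemma natDegree_minpoly_residue_le {x : unitBallRing C} (hx : IsIntegral ℚ_[p] (x : C)) :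
    (minpoly (ZMod p) (normResidue x)).natDegree ≤ (minpoly ℚ_[p] (x : C)).natDegree := by
  by_contra! hlt
  obtain ⟨i, -, h⟩ := exists_norm_aeval_eq_norm_coeff hlt
  have := h (minpoly ℚ_[p] (x : C)).natDegree
  rw [minpoly.aeval, norm_zero, coeff_natDegree, minpoly.monic hx, norm_one] at this
  linarith

end NormedResidue

section PadicExtension

variable {p : ℕ} [Fact p.Prime] {C : Type*} [NormedField C] [NormedAlgebra ℚ_[p] C]

open IntermediateField in
/-- The norm of an algebraic element over `ℚ_[p]` is determined by its minimal polynomial. -/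
lemma norm_eq_spectralValue_minpoly {z : C} (hz : IsIntegral ℚ_[p] z) :
    ‖z‖ = spectralValue (minpoly ℚ_[p] z) := by
  have : FiniteDimensional ℚ_[p] ℚ_[p]⟮z⟯ := adjoin.finiteDimensional hz
  let f : AbsoluteValue ℚ_[p]⟮z⟯ ℝ :=
    { toFun := fun x => ‖(x : C)‖
      map_mul' := fun x y => by simp
      nonneg' := fun x => norm_nonneg _
      eq_zero' := fun x => by simp
      add_le' := fun x y => norm_add_le _ _ }
  have h := spectralNorm_unique_field_norm_ext (K := ℚ_[p]) (f := f)
    (fun x => norm_algebraMap' C x) (AdjoinSimple.gen ℚ_[p] z)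
  rw [spectralNorm, minpoly_gen] at h
  exact h

open IntermediateField in
lemma norm_aeval_eq_of_minpoly_eq {x y : C} (hx : IsIntegral ℚ_[p] x)
    (hxy : aeval y (minpoly ℚ_[p] x) = 0) (g : ℚ_[p][X]) :
    ‖aeval x g‖ = ‖aeval y g‖ := by
  have hy : y ∈ (minpoly ℚ_[p] x).aroots C :=
    (mem_aroots).2 ⟨minpoly.ne_zero hx, hxy⟩
  let φ : ℚ_[p]⟮x⟯ →ₐ[ℚ_[p]] C := (algHomAdjoinIntegralEquiv ℚ_[p] hx).symm ⟨y, hy⟩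
  have hφ : φ (AdjoinSimple.gen ℚ_[p] x) = y := algHomAdjoinIntegralEquiv_symm_apply_gen _ hx _
  have h1 : aeval x g = (aeval (AdjoinSimple.gen ℚ_[p] x) g : ℚ_[p]⟮x⟯) := by
    rw [← coe_val, ← aeval_algHom_apply, coe_val, AdjoinSimple.coe_gen]
  have h2 : aeval y g = φ (aeval (AdjoinSimple.gen ℚ_[p] x) g) := by
    rw [← aeval_algHom_apply, hφ]
  have : FiniteDimensional ℚ_[p] ℚ_[p]⟮x⟯ := adjoin.finiteDimensional hx
  have hi : IsIntegral ℚ_[p] (aeval (AdjoinSimple.gen ℚ_[p] x) g) := IsIntegral.of_finite _ _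
  rw [h1, h2, ← coe_val, norm_eq_spectralValue_minpoly (hi.map (ℚ_[p]⟮x⟯.val)),
    norm_eq_spectralValue_minpoly (hi.map φ), minpoly.algHom_eq _ φ.toRingHom.injective,
    minpoly.algHom_eq _ (ℚ_[p]⟮x⟯.val).toRingHom.injective]

variable [IsUltrametricDist C]

/-- Reduction is injective on roots of unity of order `p ^ d - 1`. -/
lemma eq_of_norm_sub_lt_one {d : ℕ} (hd : d ≠ 0) {x y : C} (hx : x ^ (p ^ d - 1) = 1)
    (hy : y ^ (p ^ d - 1) = 1) (hxy : ‖x - y‖ < 1) : x = y := by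
  have hp := (Fact.out : p.Prime)
  have hq : 2 ≤ p ^ d := hp.two_le.trans (Nat.le_self_pow hd p)
  have hq0 : p ^ d - 1 ≠ 0 := by omega
  have hny : ‖y‖ = 1 := by
    have := congrArg norm hy
    rwa [norm_pow, norm_one, pow_eq_one_iff_of_nonneg (norm_nonneg _) hq0] at this
  have hy0 : y ≠ 0 := norm_ne_zero_iff.1 (by rw [hny]; exact one_ne_zero)
  set η := x / y with hη
  have hη1 : η ^ (p ^ d - 1) = 1 := by rw [hη, div_pow, hx, hy, div_one]
  have hnη : ‖η‖ = 1 := by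
    have := congrArg norm hη1
    rwa [norm_pow, norm_one, pow_eq_one_iff_of_nonneg (norm_nonneg _) hq0] at this
  have hlt : ‖η - 1‖ < 1 := by
    have : η - 1 = (x - y) / y := by rw [hη]; field_simp
    rw [this, norm_div, hny, div_one]; exact hxy
  suffices η = 1 by rwa [hη, div_eq_one_iff_eq hy0] at this
  by_contra hne
  have hsum : ∑ i ∈ Finset.range (p ^ d - 1), η ^ i = 0 := by
    have := geom_sum_mul η (p ^ d - 1)
    rw [hη1, sub_self, mul_eq_zero] at this
    exact this.resolve_right (sub_ne_zero.2 hne)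
  let η' : unitBallRing C := ⟨η, mem_unitBallRing.2 hnη.le⟩
  have h1 : normResidue η' = 1 := by
    rw [← map_one normResidue, normResidue_eq_iff]; exact hlt
  have h2 : ∑ i ∈ Finset.range (p ^ d - 1), η' ^ i = 0 := by
    apply Subtype.ext
    push_cast
    exact hsum
  have h3 := congrArg (normResidue (C := C)) h2
  rw [map_sum, map_zero] at h3
  simp only [map_pow, h1, one_pow, Finset.sum_const, Finset.card_range, nsmul_eq_mul, mul_one] at h3
  have := normResidueField_charP p C
  rw [Nat.cast_sub (by omega), Nat.cast_pow, CharP.cast_eq_zero, zero_pow hd] at h3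
  simp at h3

/-- Roots of unity of order prime to `p` generate extensions without degree drop. -/
lemma natDegree_minpoly_le_residue {d : ℕ} (hd : d ≠ 0) {ζ : unitBallRing C}
    (hζ : (ζ : C) ^ (p ^ d - 1) = 1)
    (hs : ((minpoly ℚ_[p] (ζ : C)).map (algebraMap ℚ_[p] C)).Splits) :
    (minpoly ℚ_[p] (ζ : C)).natDegree ≤ (minpoly (ZMod p) (normResidue ζ)).natDegree := by
  classical
  have hq : 2 ≤ p ^ d := (Fact.out : p.Prime).two_le.trans (Nat.le_self_pow hd p)
  have hint : IsIntegral ℚ_[p] (ζ : C) :=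
    IsIntegral.of_pow (n := p ^ d - 1) (by omega) (by rw [hζ]; exact isIntegral_one)
  have hζ' : ζ ^ (p ^ d - 1) = 1 := Subtype.ext hζ
  have hint' : IsIntegral (ZMod p) (normResidue ζ) :=
    IsIntegral.of_pow (n := p ^ d - 1) (by omega)
      (by rw [← map_pow, hζ', map_one]; exact isIntegral_one)
  have hcard : ((minpoly ℚ_[p] (ζ : C)).aroots C).toFinset.card =
      (minpoly ℚ_[p] (ζ : C)).natDegree := by
    rw [Multiset.toFinset_card_of_nodup, aroots_def, ← hs.natDegree_eq_card_roots, natDegree_map]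
    exact nodup_aroots_iff_of_splits (minpoly.ne_zero hint) hs |>.2
      (minpoly.irreducible hint).separable
  have hroot : ∀ x ∈ ((minpoly ℚ_[p] (ζ : C)).aroots C).toFinset, x ^ (p ^ d - 1) = 1 := by
    intro x hx
    rw [Multiset.mem_toFinset, mem_aroots] at hx
    have hdvd : minpoly ℚ_[p] (ζ : C) ∣ X ^ (p ^ d - 1) - 1 :=
      minpoly.dvd _ _ (by simp [hζ])
    have := aeval_eq_zero_of_dvd_aeval_eq_zero hdvd hx.2
    simpa [sub_eq_zero] using this
  let r : C → NormResidueField C := fun x =>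
    if h : ‖x‖ ≤ 1 then normResidue ⟨x, mem_unitBallRing.2 h⟩ else 0
  have hr : ∀ x (h : ‖x‖ ≤ 1), r x = normResidue ⟨x, mem_unitBallRing.2 h⟩ := fun x h => dif_pos h
  rw [← hcard]
  refine (Finset.card_le_card_of_injOn r (t := ((minpoly (ZMod p) (normResidue ζ)).aroots
    (NormResidueField C)).toFinset) ?_ ?_).trans ?_
  · intro x hx
    have hx1 := norm_eq_one_of_pow_eq_one hd (hroot x hx)
    rw [Finset.mem_coe, Multiset.mem_toFinset, mem_aroots] at hx
    rw [Finset.mem_coe, Multiset.mem_toFinset, mem_aroots, hr x hx1.le]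
    refine ⟨minpoly.ne_zero hint', ?_⟩
    obtain ⟨g, hg⟩ := Polynomial.map_surjective (PadicInt.toZMod (p := p))
      (ZMod.ringHom_surjective _) (minpoly (ZMod p) (normResidue ζ))
    rw [← hg, ← normResidue_eval₂_padicInt, normResidue_eq_zero, coe_eval₂_padicInt,
      ← norm_aeval_eq_of_minpoly_eq hint hx.2, ← coe_eval₂_padicInt, ← normResidue_eq_zero,
      normResidue_eval₂_padicInt, hg, minpoly.aeval]
  · intro x hx y hy hxy
    have hx1 := hroot x hx
    have hy1 := hroot y hy
    rw [hr x (norm_eq_one_of_pow_eq_one hd hx1).le, hr y (norm_eq_one_of_pow_eq_one hd hy1).le,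
      normResidue_eq_iff] at hxy
    exact eq_of_norm_sub_lt_one hd hx1 hy1 hxy
  · refine (Multiset.toFinset_card_le _).trans ((card_roots' _).trans ?_)
    exact natDegree_map_le

/-- Norms and residues in an unramified extension `ℚ_[p](ζ)`. -/
lemma unramified_norm_and_residue {d : ℕ} (hd : d ≠ 0) {ζ : C} (hζ : ζ ^ (p ^ d - 1) = 1)
    (hs : ((minpoly ℚ_[p] ζ).map (algebraMap ℚ_[p] C)).Splits) {u : C}
    (hu : u ∈ IntermediateField.adjoin ℚ_[p] {ζ}) :
    (∃ c : ℚ_[p], ‖u‖ = ‖c‖) ∧ (‖u‖ ≤ 1 → ‖u ^ p ^ d - u‖ < 1) := by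
  have hq : 2 ≤ p ^ d := (Fact.out : p.Prime).two_le.trans (Nat.le_self_pow hd p)
  have hint : IsIntegral ℚ_[p] ζ :=
    IsIntegral.of_pow (n := p ^ d - 1) (by omega) (by rw [hζ]; exact isIntegral_one)
  let ζ' : unitBallRing C := ⟨ζ, mem_unitBallRing.2 (norm_eq_one_of_pow_eq_one hd hζ).le⟩
  have hdeg := natDegree_minpoly_le_residue (ζ := ζ') hd hζ hs
  obtain ⟨f, rfl⟩ : ∃ f : ℚ_[p][X], aeval ζ f = u := by
    rw [← IntermediateField.mem_toSubalgebra,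
      IntermediateField.adjoin_simple_toSubalgebra_of_isAlgebraic hint.isAlgebraic] at hu
    rwa [Algebra.adjoin_singleton_eq_range_aeval] at hu
  have hmod : aeval ζ (f %ₘ minpoly ℚ_[p] ζ) = aeval ζ f :=
    aeval_modByMonic_eq_self_of_root (minpoly.aeval _ _)
  set g := f %ₘ minpoly ℚ_[p] ζ
  rw [← hmod]
  obtain ⟨i, hi, hj⟩ := exists_norm_aeval_eq_norm_coeff (x := ζ') (g := g)
    ((natDegree_modByMonic_lt f (minpoly.monic hint) (minpoly.ne_one _ _)).trans_le hdeg)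
  refine ⟨⟨_, hi⟩, fun h1 => ?_⟩
  obtain ⟨h, hh⟩ := exists_padicInt_lift fun j => (hj j).trans h1
  rw [← hh]
  have h2 := coe_eval₂_padicInt h ζ'
  have h3 := normResidue_eval₂_padicInt h ζ'
  change _ = aeval ζ _ at h2
  rw [← h2]
  have := normResidueField_charP p C
  have hfix : normResidue ζ' ^ p ^ d = normResidue ζ' := by
    have h5 : ζ' ^ (p ^ d - 1) = 1 := Subtype.ext hζ
    rw [← map_pow, show p ^ d = p ^ d - 1 + 1 by omega, pow_succ, h5, one_mul]
  have h4 : normResidue (h.eval₂ (padicIntToUnitBall p C) ζ' ^ p ^ d) =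
      normResidue (h.eval₂ (padicIntToUnitBall p C) ζ') := by
    rw [map_pow, h3, ← iterateFrobenius_def, aeval_def, hom_eval₂, iterateFrobenius_def, hfix]
    congr 1
    exact RingHom.ext_zmod _ _
  rw [normResidue_eq_iff] at h4
  exact_mod_cast h4

omit [NormedAlgebra ℚ_[p] C] in
/-- Terms `c j * x ^ j` with `‖x‖ = p ^ (-1 / e)` and `‖c j‖` in the value group of `ℚ_[p]` have
distinct norms, so their sum has the maximal norm. -/
lemma exists_norm_sum_eq_of_ramified {e : ℕ} (he : e ≠ 0) {x : C}
    (hx : ‖x‖ = (p : ℝ) ^ (-(1 / e) : ℝ)) {c : ℕ → C} (hc : ∀ j, ∃ a : ℚ_[p], ‖c j‖ = ‖a‖) :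
    ∃ j < e, ‖∑ i ∈ Finset.range e, c i * x ^ i‖ = ‖c j * x ^ j‖ ∧
      ∀ i < e, ‖c i * x ^ i‖ ≤ ‖∑ i ∈ Finset.range e, c i * x ^ i‖ := by
  have hp1 : (1 : ℝ) < p := by exact_mod_cast (Fact.out : p.Prime).one_lt
  have hp0 : (0 : ℝ) < p := by positivity
  have he' : (e : ℝ) ≠ 0 := by exact_mod_cast he
  obtain ⟨j, hj, hmax⟩ := Finset.exists_max_image (Finset.range e)
    (fun i => ‖c i * x ^ i‖) ⟨0, by simpa using Nat.pos_of_ne_zero he⟩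
  refine ⟨j, Finset.mem_range.1 hj, ?_⟩
  have hval : ∀ i, c i ≠ 0 → ∃ n : ℤ, ‖c i * x ^ i‖ = (p : ℝ) ^ (-(n + i / e) : ℝ) := by
    intro i hi
    obtain ⟨a, ha⟩ := hc i
    have ha0 : a ≠ 0 := norm_ne_zero_iff.1 (by rw [← ha]; exact norm_ne_zero_iff.2 hi)
    refine ⟨a.valuation, ?_⟩
    rw [norm_mul, norm_pow, ha, hx, Padic.norm_eq_zpow_neg_valuation ha0, ← Real.rpow_intCast,
      ← Real.rpow_natCast, ← Real.rpow_mul hp0.le, ← Real.rpow_add hp0]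
    congr 1
    push_cast
    ring
  have hne : ∀ i < e, ∀ k < e, i ≠ k → c i ≠ 0 → c k ≠ 0 → ‖c i * x ^ i‖ ≠ ‖c k * x ^ k‖ := by
    intro i hi k hk hik hci hck heq
    obtain ⟨n, hn⟩ := hval i hci
    obtain ⟨m, hm⟩ := hval k hck
    rw [hn, hm] at heq
    have h1 := Real.rpow_right_inj hp0 hp1.ne' |>.1 heq
    have h2 : (n : ℝ) * e + i = m * e + k := by
      field_simp at h1
      linarith
    have h3 : n * (e : ℤ) + i = m * e + k := by exact_mod_cast h2
    have h4 : (i : ℤ) % e = (k : ℤ) % e := by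
      have := congrArg (· % (e : ℤ)) h3
      simpa using this
    rw [Int.emod_eq_of_lt (by omega) (by omega), Int.emod_eq_of_lt (by omega) (by omega)] at h4
    omega
  suffices h : ‖∑ i ∈ Finset.range e, c i * x ^ i‖ = ‖c j * x ^ j‖ from
    ⟨h, fun i hi => (hmax i (by simpa using hi)).trans h.ge⟩
  have hx0 : x ≠ 0 := norm_ne_zero_iff.1 (by rw [hx]; positivity)
  by_cases hcj : c j = 0
  · rw [hcj, zero_mul, norm_zero]
    refine norm_eq_zero.2 (Finset.sum_eq_zero fun i hi => ?_)
    have := hmax i hi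
    rw [hcj, zero_mul, norm_zero] at this
    exact norm_le_zero_iff.1 this
  · rw [← Finset.add_sum_erase _ _ hj]
    have hpos : 0 < ‖c j * x ^ j‖ := norm_pos_iff.2 (mul_ne_zero hcj (pow_ne_zero _ hx0))
    have hlt : ‖∑ i ∈ (Finset.range e).erase j, c i * x ^ i‖ < ‖c j * x ^ j‖ := by
      obtain h0 | hne0 := ((Finset.range e).erase j).eq_empty_or_nonempty
      · rw [h0, Finset.sum_empty, norm_zero]; exact hpos
      obtain ⟨i, hi, hle⟩ := IsUltrametricDist.exists_norm_finsetSum_le_of_nonempty hne0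
        (fun i => c i * x ^ i)
      refine hle.trans_lt ?_
      rw [Finset.mem_erase] at hi
      by_cases hci : c i = 0
      · rw [hci, zero_mul, norm_zero]; exact hpos
      · exact lt_of_le_of_ne (hmax i hi.2) (hne i (by simpa using hi.2) j (by simpa using hj)
          hi.1 hci hcj)
    rw [IsUltrametricDist.norm_add_eq_max_of_norm_ne_norm hlt.ne', max_eq_left hlt.le]

/-- The degree of an element of norm `p ^ (-1 / e)` is at least `e`. -/
lemma le_natDegree_minpoly_of_norm {e : ℕ} {x : C}
    (hx : ‖x‖ = (p : ℝ) ^ (-(1 / e) : ℝ)) (hint : IsIntegral ℚ_[p] x) :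
    e ≤ (minpoly ℚ_[p] x).natDegree := by
  by_contra! hlt
  have he : e ≠ 0 := by omega
  have hx0 : x ≠ 0 := norm_ne_zero_iff.1 (by
    have := (Fact.out : p.Prime).pos
    rw [hx]; positivity)
  obtain ⟨j, -, -, h⟩ := exists_norm_sum_eq_of_ramified he hx
    (c := fun i => algebraMap ℚ_[p] C ((minpoly ℚ_[p] x).coeff i))
    (fun j => ⟨_, norm_algebraMap' _ _⟩)
  have hsum : ∑ i ∈ Finset.range e, algebraMap ℚ_[p] C ((minpoly ℚ_[p] x).coeff i) * x ^ i = 0 := by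
    rw [← minpoly.aeval ℚ_[p] x, aeval_def, eval₂_eq_sum_range' _ hlt]
  have h1 := h _ hlt
  rw [hsum, norm_zero, coeff_natDegree, minpoly.monic hint, map_one, one_mul] at h1
  exact pow_ne_zero _ hx0 (norm_le_zero_iff.1 h1)

open IntermediateField in
/-- Norms and residues in an extension `ℚ_[p](ζ, π)` with `ζ` a root of unity of order dividing
`p ^ d - 1` and `π ^ e = p`. -/
lemma adjoin_pair_norm_and_residue {d e : ℕ} (hd : d ≠ 0) (he : e ≠ 0) {ζ π : C}
    (hζ : ζ ^ (p ^ d - 1) = 1)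
    (hs : ((minpoly ℚ_[p] ζ).map (algebraMap ℚ_[p] C)).Splits) (hπ : π ^ e = (p : C)) {u : C}
    (hu : u ∈ adjoin ℚ_[p] {ζ, π}) :
    (u ≠ 0 → ∃ n : ℤ, ‖u‖ = (p : ℝ) ^ (-(n / e) : ℝ)) ∧ (‖u‖ ≤ 1 → ‖u ^ p ^ d - u‖ < 1) := by
  have hp1 : (1 : ℝ) < p := by exact_mod_cast (Fact.out : p.Prime).one_lt
  have hp0 : (0 : ℝ) < p := by positivity
  have he' : (e : ℝ) ≠ 0 := by exact_mod_cast he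
  have hnπ : ‖π‖ = (p : ℝ) ^ (-(1 / e) : ℝ) := by
    have h1 : ‖π‖ ^ e = (p : ℝ)⁻¹ := by
      have : ((p : ℕ) : C) = algebraMap ℚ_[p] C (p : ℚ_[p]) := by simp
      rw [← norm_pow, hπ, this, norm_algebraMap', Padic.norm_p]
    rw [← Real.pow_rpow_inv_natCast (norm_nonneg π) he, h1, ← Real.rpow_neg_one,
      ← Real.rpow_mul hp0.le]
    congr 1
    ring
  let K := ℚ_[p]⟮ζ⟯
  have hintπ : IsIntegral K π := IsIntegral.of_pow (Nat.pos_of_ne_zero he) (by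
    rw [hπ]; exact_mod_cast isIntegral_algebraMap (R := K) (x := (p : K)))
  have hu' : u ∈ K⟮π⟯ := by
    rw [← mem_restrictScalars ℚ_[p], adjoin_simple_adjoin_simple]
    exact hu
  obtain ⟨f, rfl⟩ : ∃ f : K[X], aeval π f = u := by
    rw [← mem_toSubalgebra, adjoin_simple_toSubalgebra_of_isAlgebraic hintπ.isAlgebraic,
      Algebra.adjoin_singleton_eq_range_aeval] at hu'
    exact hu'
  have hmonic : (X ^ e - Polynomial.C (p : K)).Monic := monic_X_pow_sub_C _ he
  have hmod : aeval π (f %ₘ (X ^ e - Polynomial.C (p : K))) = aeval π f :=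
    aeval_modByMonic_eq_self_of_root (by simp [hπ])
  have hlt : (f %ₘ (X ^ e - Polynomial.C (p : K))).natDegree < e := by
    have := natDegree_modByMonic_lt f hmonic (fun h => he (by
      have := congrArg natDegree h
      rwa [natDegree_X_pow_sub_C, natDegree_one] at this))
    rwa [natDegree_X_pow_sub_C] at this
  set g := f %ₘ (X ^ e - Polynomial.C (p : K))
  rw [← hmod]
  set c : ℕ → C := fun i => (g.coeff i : C) with hcdef
  have hc : ∀ i, (∃ a : ℚ_[p], ‖c i‖ = ‖a‖) ∧ (‖c i‖ ≤ 1 → ‖c i ^ p ^ d - c i‖ < 1) := fun i =>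
    unramified_norm_and_residue hd hζ hs (g.coeff i).2
  have hsum : aeval π g = ∑ i ∈ Finset.range e, c i * π ^ i := by
    rw [aeval_def, eval₂_eq_sum_range' _ hlt]; rfl
  obtain ⟨j, hj, hje, hmax⟩ := exists_norm_sum_eq_of_ramified he hnπ fun i => (hc i).1
  rw [← hsum] at hje hmax
  refine ⟨fun hne => ?_, fun hle => ?_⟩
  · obtain ⟨a, ha⟩ := (hc j).1
    have ha0 : a ≠ 0 := by
      rintro rfl
      rw [norm_mul, ha, norm_zero, zero_mul] at hje
      exact hne (norm_eq_zero.1 hje)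
    refine ⟨a.valuation * e + j, ?_⟩
    rw [hje, norm_mul, norm_pow, ha, hnπ, Padic.norm_eq_zpow_neg_valuation ha0,
      ← Real.rpow_intCast, ← Real.rpow_natCast, ← Real.rpow_mul hp0.le, ← Real.rpow_add hp0]
    congr 1
    push_cast
    field_simp
    ring
  · have hpos : 0 < e := Nat.pos_of_ne_zero he
    have h0 : ‖c 0‖ ≤ 1 := by simpa using (hmax 0 hpos).trans hle
    have hterm : ∀ i < e, i ≠ 0 → ‖c i * π ^ i‖ < 1 := by
      intro i hi hi0
      refine lt_of_le_of_ne ((hmax i hi).trans hle) fun h1 => ?_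
      obtain ⟨a, ha⟩ := (hc i).1
      have ha0 : a ≠ 0 := by
        rintro rfl
        rw [norm_mul, ha, norm_zero, zero_mul] at h1
        exact zero_ne_one h1
      rw [norm_mul, norm_pow, ha, hnπ, Padic.norm_eq_zpow_neg_valuation ha0,
        ← Real.rpow_intCast, ← Real.rpow_natCast, ← Real.rpow_mul hp0.le, ← Real.rpow_add hp0] at h1
      have h2 := Real.rpow_right_inj hp0 hp1.ne' |>.1 (h1.trans (Real.rpow_zero (p : ℝ)).symm)
      push_cast at h2
      have h3 : (a.valuation : ℝ) * e + i = 0 := by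
        field_simp at h2
        linarith
      have h4 : a.valuation * (e : ℤ) + i = 0 := by exact_mod_cast h3
      have h5 : (e : ℤ) ∣ i := ⟨-a.valuation, by linarith⟩
      exact absurd (Nat.le_of_dvd (Nat.pos_of_ne_zero hi0) (Int.natCast_dvd_natCast.1 h5))
        (by omega)
    have hdiff : ‖aeval π g - c 0‖ < 1 := by
      rw [hsum, ← Finset.add_sum_erase _ _ (Finset.mem_range.2 hpos), pow_zero, mul_one,
        add_sub_cancel_left]
      obtain hE | hE := ((Finset.range e).erase 0).eq_empty_or_nonempty
      · rw [hE, Finset.sum_empty, norm_zero]; exact one_pos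
      obtain ⟨i, hi, hle'⟩ := IsUltrametricDist.exists_norm_finsetSum_le_of_nonempty hE
        (fun i => c i * π ^ i)
      rw [Finset.mem_erase] at hi
      exact hle'.trans_lt (hterm i (by simpa using hi.2) hi.1)
    let y : unitBallRing C := ⟨aeval π g, mem_unitBallRing.2 hle⟩
    let z : unitBallRing C := ⟨c 0, mem_unitBallRing.2 h0⟩
    have hyz : normResidue y = normResidue z := normResidue_eq_iff.2 hdiff
    have hz : normResidue (z ^ p ^ d) = normResidue z :=
      normResidue_eq_iff.2 (by simpa using (hc 0).2 h0)
    have hy : normResidue (y ^ p ^ d) = normResidue y := by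
      rw [map_pow, hyz, ← map_pow, hz]
    simpa using normResidue_eq_iff.1 hy

end PadicExtension

section GenericElement

open IntermediateField Topology

variable {F C : Type*} [NontriviallyNormedField F] [NormedField C] [NormedAlgebra F C]

lemma eventually_exists_adjoin_norm_sub_lt {s y : C} (hs : IsIntegral F s) (hy : y ∈ F⟮s⟯)
    {ε : ℝ} (hε : 0 < ε) : ∀ᶠ z in 𝓝 s, ∃ x ∈ F⟮z⟯, ‖x - y‖ < ε := by
  obtain ⟨f, rfl⟩ : ∃ f : F[X], aeval s f = y := by
    rwa [← mem_toSubalgebra, adjoin_simple_toSubalgebra_of_isAlgebraic hs.isAlgebraic,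
      Algebra.adjoin_singleton_eq_range_aeval] at hy
  have hc : Continuous fun z : C => aeval z f := f.continuous_aeval
  filter_upwards [(Metric.tendsto_nhds.1 (hc.tendsto s)) ε hε] with z hz
  refine ⟨aeval z f, ?_, by rwa [← dist_eq_norm]⟩
  exact algebra_adjoin_le_adjoin F {z} (aeval_mem_adjoin_singleton F z)

/-- Every algebraic `a` is approximated by elements generating a field that contains a given
algebraic `y`. -/
lemma exists_norm_sub_lt_mem_adjoin [CharZero F] {a y : C} (ha : IsIntegral F a)
    (hy : IsIntegral F y) {ε : ℝ} (hε : 0 < ε) :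
    ∃ z ∈ adjoin F {a, y}, ‖z - a‖ < ε ∧ y ∈ F⟮z⟯ := by
  obtain ⟨t, ht0, ht1⟩ := NormedField.exists_norm_lt_one F
  have ht : t ≠ 0 := norm_pos_iff.1 ht0
  let L := adjoin F {a, y}
  have : FiniteDimensional F L := finiteDimensional_adjoin (by
    rintro x (rfl | rfl) <;> assumption)
  have hfin : Finite (IntermediateField F L) :=
    Field.finite_intermediateField_of_exists_primitive_element F L
      (Field.exists_primitive_element F L)
  let a' : L := ⟨a, subset_adjoin F _ (by simp)⟩
  let y' : L := ⟨y, subset_adjoin F _ (by simp)⟩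
  have htend : Tendsto (fun n : ℕ => ‖t ^ n • y‖) atTop (𝓝 0) := by
    simp only [norm_smul, norm_pow]
    simpa using (tendsto_pow_atTop_nhds_zero_of_lt_one ht0.le ht1).mul_const ‖y‖
  obtain ⟨N, hN⟩ := eventually_atTop.1 (htend.eventually_lt_const hε)
  obtain ⟨n, m, hnm, heq⟩ := Finite.exists_ne_map_eq_of_infinite
    (fun n : ℕ => F⟮a' + t ^ (n + N) • y'⟯)
  refine ⟨a + t ^ (n + N) • y, (a' + t ^ (n + N) • y').2, ?_, ?_⟩
  · rw [add_sub_cancel_left]; exact hN _ (by omega)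
  · have h1 : a' + t ^ (n + N) • y' ∈ F⟮a' + t ^ (n + N) • y'⟯ := mem_adjoin_simple_self F _
    have h2 : a' + t ^ (m + N) • y' ∈ F⟮a' + t ^ (n + N) • y'⟯ := by
      have := mem_adjoin_simple_self F (a' + t ^ (m + N) • y')
      rwa [← heq] at this
    have h3 : (t ^ (n + N) - t ^ (m + N)) • y' ∈ F⟮a' + t ^ (n + N) • y'⟯ := by
      have := sub_mem h1 h2
      rwa [add_sub_add_left_eq_sub, ← sub_smul] at this
    have h4 : t ^ (n + N) - t ^ (m + N) ≠ 0 := by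
      rw [sub_ne_zero]
      intro h
      have h5 := congrArg norm h
      rw [norm_pow, norm_pow] at h5
      exact hnm (by have := pow_right_injective₀ ht0 ht1.ne h5; omega)
    have h6 : y' ∈ F⟮a' + t ^ (n + N) • y'⟯ := by
      have := (F⟮a' + t ^ (n + N) • y'⟯).smul_mem h3 (x := (t ^ (n + N) - t ^ (m + N))⁻¹)
      rwa [smul_smul, inv_mul_cancel₀ h4, one_smul] at this
    have h7 : y ∈ (F⟮a' + t ^ (n + N) • y'⟯).map L.val := ⟨y', h6, rfl⟩
    rw [adjoin_map, Set.image_singleton] at h7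
    exact h7

/-- In the closure of an algebraic extension `K / F` some element `α` is generic, in the sense
that the closure of `F(α)` contains a given countable subset of `K`. -/
lemma exists_mem_closure_subset_closure_adjoin [CharZero F] [CompleteSpace C]
    {K : IntermediateField F C} (hK : ∀ x ∈ K, IsIntegral F x) {T : Set C} (hT : T.Countable)
    (hTK : T ⊆ K) :
    ∃ α ∈ closure (K : Set C), T ⊆ closure (F⟮α⟯ : Set C) := by
  have := hT.to_subtype
  have hcl : IsClosed (closure (K : Set C)) := isClosed_closure
  have : CompleteSpace (closure (K : Set C)) := hcl.completeSpace_coe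
  let U : T × ℕ → Set (closure (K : Set C)) := fun i =>
    interior {z | ∃ x ∈ F⟮(z : C)⟯, ‖x - i.1‖ < 1 / ((i.2 : ℝ) + 1)}
  have hdense : ∀ i, Dense (U i) := by
    rintro ⟨y, m⟩
    have hyK := hTK y.2
    rw [Metric.dense_iff]
    rintro ⟨w, hw⟩ r hr
    obtain ⟨a, haK, haw⟩ := Metric.mem_closure_iff.1 hw (r / 2) (half_pos hr)
    obtain ⟨z, hz, hza, hyz⟩ :=
      exists_norm_sub_lt_mem_adjoin (hK a haK) (hK y hyK) (half_pos hr)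
    have hzK : z ∈ K := by
      refine (adjoin_le_iff (T := K)).2 ?_ hz
      rintro x (rfl | rfl) <;> assumption
    refine ⟨⟨z, subset_closure hzK⟩, ?_, ?_⟩
    · rw [Metric.mem_ball, Subtype.dist_eq]
      calc dist z w ≤ dist z a + dist a w := dist_triangle _ _ _
        _ < r := by rw [dist_comm a w, dist_eq_norm z a]; linarith
    · rw [mem_interior_iff_mem_nhds]
      have h := eventually_exists_adjoin_norm_sub_lt (hK z hzK) hyz
        (ε := 1 / ((m : ℝ) + 1)) (by positivity)
      exact (continuous_subtype_val.tendsto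
        (⟨z, subset_closure hzK⟩ : closure (K : Set C))).eventually h
  have hne : Nonempty (closure (K : Set C)) := ⟨⟨0, subset_closure K.zero_mem⟩⟩
  obtain ⟨α, hα⟩ := (dense_iInter_of_isOpen (fun i => isOpen_interior) hdense).nonempty
  refine ⟨α, α.2, fun y hy => Metric.mem_closure_iff.2 fun ε hε => ?_⟩
  obtain ⟨m, hm⟩ := exists_nat_one_div_lt hε
  obtain ⟨x, hx, hxy⟩ := interior_subset (Set.mem_iInter.1 hα (⟨y, hy⟩, m))
  exact ⟨x, hx, by rw [dist_comm, dist_eq_norm]; exact hxy.trans hm⟩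

end GenericElement

section Tower

open IntermediateField

lemma exists_compatible_roots {L : Type*} [Field L] [IsAlgClosed L] (a : L) :
    ∃ π : ℕ → L, (∀ e, 1 ≤ e → π e ^ e = a) ∧
      ∀ e f, 1 ≤ e → 1 ≤ f → π (e * f) ^ f = π e := by
  have hroot : ∀ (n : ℕ) (b : L), ∃ c, c ^ (n + 1) = b := fun n b =>
    IsAlgClosed.exists_pow_nat_eq b n.succ_pos
  choose r hr using hroot
  let w : ℕ → L := fun n => n.rec a r
  have hw : ∀ n, w (n + 1) ^ (n + 1) = w n := fun n => hr n _
  have hw' : ∀ n m, ∀ c, (n + m).factorial = c * n.factorial → w (n + m) ^ c = w n := by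
    intro n m
    induction m with
    | zero =>
      intro c hc
      have : c = 1 := Nat.eq_of_mul_eq_mul_right n.factorial_pos (by simpa using hc.symm)
      simp [this]
    | succ m ih =>
      intro c hc
      obtain ⟨c', hc'⟩ : n.factorial ∣ (n + m).factorial := Nat.factorial_dvd_factorial (by omega)
      rw [mul_comm] at hc'
      have : c = (n + m + 1) * c' := by
        refine Nat.eq_of_mul_eq_mul_right n.factorial_pos ?_
        rw [← hc, ← add_assoc, Nat.factorial_succ, hc', mul_assoc]
      rw [this, ← add_assoc, pow_mul, hw, ih c' hc']
  refine ⟨fun e => w e ^ (e - 1).factorial, fun e he => ?_, fun e f he hf => ?_⟩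
  · have := hw' 0 e e.factorial (by simp)
    rw [zero_add] at this
    rw [← pow_mul, mul_comm, Nat.mul_factorial_pred (by omega), this]
    rfl
  · have hle : e ≤ e * f := Nat.le_mul_of_pos_right e hf
    obtain ⟨c, hc⟩ : e.factorial ∣ (e * f).factorial := Nat.factorial_dvd_factorial hle
    have hc' : (e * f - 1).factorial * f = c * (e - 1).factorial := by
      refine Nat.eq_of_mul_eq_mul_left he ?_
      have h1 := Nat.mul_factorial_pred (n := e * f) (by positivity)
      have h2 := Nat.mul_factorial_pred (n := e) (by omega)
      calc e * ((e * f - 1).factorial * f) = e * f * (e * f - 1).factorial := by ring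
        _ = c * (e * (e - 1).factorial) := by rw [h1, h2, hc, mul_comm]
        _ = _ := by ring
    have := hw' e (e * f - e) c (by rw [Nat.add_sub_cancel' hle, hc, mul_comm])
    rw [Nat.add_sub_cancel' hle] at this
    simp only
    rw [← pow_mul, hc', pow_mul, this]

variable {p : ℕ} [Fact p.Prime] {C : Type*} [NormedField C] [NormedAlgebra ℚ_[p] C]
  [IsUltrametricDist C]

/-- The compositum of the fields obtained by adjoining roots of unity of order `p ^ d - 1` and
compatible `e`-th roots of `p`, for `d` and `e` in prescribed directed sets. -/
lemma exists_tower (ι : AlgebraicClosure ℚ_[p] →ₐ[ℚ_[p]] C) {P Q : ℕ → Prop} (hP1 : P 1)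
    (hQ1 : Q 1) (hP : ∀ d e, 1 ≤ d → 1 ≤ e → P d → P e → ∃ n, 1 ≤ n ∧ P n ∧ d ∣ n ∧ e ∣ n)
    (hQ : ∀ d e, 1 ≤ d → 1 ≤ e → Q d → Q e → ∃ n, 1 ≤ n ∧ Q n ∧ d ∣ n ∧ e ∣ n) :
    ∃ (K : IntermediateField ℚ_[p] C) (T : Set C), T.Countable ∧ T ⊆ K ∧
      (∀ x ∈ K, IsIntegral ℚ_[p] x) ∧
      (∀ x ∈ K, ∃ d e : ℕ, 1 ≤ d ∧ 1 ≤ e ∧ P d ∧ Q e ∧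
        (x ≠ 0 → ∃ n : ℤ, ‖x‖ = (p : ℝ) ^ (-(n / e) : ℝ)) ∧
        (‖x‖ ≤ 1 → ‖x ^ p ^ d - x‖ < 1)) ∧
      (∀ d, 1 ≤ d → P d → ∃ ζ ∈ T, IsPrimitiveRoot ζ (p ^ d - 1)) ∧
      ∀ e, 1 ≤ e → Q e → ∃ π ∈ T, π ^ e = (p : C) := by
  have hp := (Fact.out : p.Prime)
  obtain ⟨π, hπ, hπ'⟩ := exists_compatible_roots (p : AlgebraicClosure ℚ_[p])
  have hpos : ∀ d, 1 ≤ d → p ^ d - 1 ≠ 0 := fun d hd => by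
    have := Nat.one_lt_pow (n := d) (by omega) hp.one_lt
    omega
  have hζ : ∀ d, ∃ z : AlgebraicClosure ℚ_[p], 1 ≤ d → IsPrimitiveRoot z (p ^ d - 1) := fun d => by
    by_cases hd : 1 ≤ d
    · have : NeZero (p ^ d - 1) := ⟨hpos d hd⟩
      obtain ⟨z, hz⟩ := HasEnoughRootsOfUnity.exists_primitiveRoot (AlgebraicClosure ℚ_[p])
        (p ^ d - 1)
      exact ⟨z, fun _ => hz⟩
    · exact ⟨0, fun h => absurd h hd⟩
  choose ζ hζ using hζ
  let I := {i : ℕ × ℕ // 1 ≤ i.1 ∧ 1 ≤ i.2 ∧ P i.1 ∧ Q i.2}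
  have hI : Nonempty I := ⟨⟨(1, 1), le_rfl, le_rfl, hP1, hQ1⟩⟩
  let F : I → IntermediateField ℚ_[p] C := fun i => adjoin ℚ_[p] {ι (ζ i.1.1), ι (π i.1.2)}
  have hζF : ∀ i, ι (ζ i.1.1) ∈ F i := fun i => subset_adjoin _ _ (by simp)
  have hπF : ∀ i, ι (π i.1.2) ∈ F i := fun i => subset_adjoin _ _ (by simp)
  have hle : ∀ i j : I, i.1.1 ∣ j.1.1 → i.1.2 ∣ j.1.2 → F i ≤ F j := by
    rintro ⟨⟨d, e⟩, hd, he, hPd, hQe⟩ j hdj hej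
    have hj := j.2
    refine adjoin_le_iff.2 ?_
    rintro x (rfl | rfl)
    · have : NeZero (p ^ j.1.1 - 1) := ⟨hpos _ hj.1⟩
      obtain ⟨m, -, hm⟩ := (hζ _ hj.1).eq_pow_of_pow_eq_one (ξ := ζ d) (by
        obtain ⟨c, hc⟩ := Nat.pow_sub_one_dvd_pow_sub_one p hdj
        rw [hc, pow_mul, (hζ d hd).pow_eq_one, one_pow])
      rw [← hm, map_pow]
      exact pow_mem (hζF j) m
    · obtain ⟨b, hb⟩ := hej
      simp only at hb
      have hb1 : 1 ≤ b := Nat.pos_of_ne_zero (by rintro rfl; simp at hb; omega)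
      have := hπ' e b he hb1
      rw [← hb] at this
      rw [← this, map_pow]
      exact pow_mem (hπF j) b
  have hdir : Directed (· ≤ ·) F := by
    rintro ⟨⟨d, e⟩, hd, he, hPd, hQe⟩ ⟨⟨d', e'⟩, hd', he', hPd', hQe'⟩
    obtain ⟨n, hn, hPn, h1, h2⟩ := hP d d' hd hd' hPd hPd'
    obtain ⟨m, hm, hQm, h3, h4⟩ := hQ e e' he he' hQe hQe'
    exact ⟨⟨(n, m), hn, hm, hPn, hQm⟩, hle _ _ h1 h3, hle _ _ h2 h4⟩
  have hmem : ∀ x, x ∈ (⨆ i, F i : IntermediateField ℚ_[p] C) ↔ ∃ i, x ∈ F i := fun x => by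
    rw [← SetLike.mem_coe, coe_iSup_of_directed hdir]
    simp
  have hint : ∀ z, IsIntegral ℚ_[p] (ι z) := fun z =>
    (Algebra.IsIntegral.isIntegral (R := ℚ_[p]) z).map ι
  refine ⟨⨆ i, F i, Set.range (fun i : I => ι (ζ i.1.1)) ∪ Set.range (fun i : I => ι (π i.1.2)),
    (Set.countable_range _).union (Set.countable_range _), ?_, ?_, ?_, ?_, ?_⟩
  · rintro x (⟨i, rfl⟩ | ⟨i, rfl⟩)
    · exact (hmem _).2 ⟨i, hζF i⟩
    · exact (hmem _).2 ⟨i, hπF i⟩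
  · intro x hx
    obtain ⟨i, hi⟩ := (hmem x).1 hx
    have : Algebra.IsAlgebraic ℚ_[p] (F i) := isAlgebraic_adjoin (by
      rintro x (rfl | rfl) <;> exact hint _)
    exact (isIntegral_iff.1 (Algebra.IsIntegral.isIntegral (R := ℚ_[p]) (⟨x, hi⟩ : F i)))
  · intro x hx
    obtain ⟨i, hi⟩ := (hmem x).1 hx
    obtain ⟨hd, he, hPd, hQe⟩ := i.2
    refine ⟨_, _, hd, he, hPd, hQe, ?_⟩
    refine adjoin_pair_norm_and_residue (by omega) (by omega)
      (by rw [← map_pow, (hζ _ hd).pow_eq_one, map_one]) ?_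
      (by rw [← map_pow, hπ _ he, map_natCast]) hi
    rw [minpoly.algHom_eq ι ι.injective, ← ι.comp_algebraMap, ← Polynomial.map_map]
    exact (IsAlgClosed.splits _).map _
  · intro d hd hPd
    refine ⟨_, Or.inl ⟨⟨(d, 1), hd, le_rfl, hPd, hQ1⟩, rfl⟩, ?_⟩
    exact (hζ d hd).map_of_injective ι.injective
  · intro e he hQe
    refine ⟨_, Or.inr ⟨⟨(1, e), le_rfl, he, hP1, hQe⟩, rfl⟩, ?_⟩
    simp only
    rw [← map_pow, hπ _ he, map_natCast]

end Tower

section FrobeniusPeriod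

variable {p : ℕ} [Fact p.Prime]

lemma dvd_of_frobenius_period {R : Type*} [CommSemiring R] [CharP R p] {x : R} {d n : ℕ}
    (hd : 1 ≤ d) (hx : x ^ p ^ d = x) (hmin : ∀ e, 1 ≤ e → e < d → x ^ p ^ e ≠ x)
    (hn : x ^ p ^ n = x) : d ∣ n := by
  have hper : ∀ m, Function.IsPeriodicPt (frobenius R p) m x ↔ x ^ p ^ m = x := fun m => by
    rw [Function.IsPeriodicPt, Function.IsFixedPt, ← coe_iterateFrobenius, iterateFrobenius_def]
  have h : Function.minimalPeriod (frobenius R p) x = d := by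
    refine le_antisymm (((hper d).2 hx).minimalPeriod_le hd) (not_lt.1 fun hlt => ?_)
    exact hmin _ (((hper d).2 hx).minimalPeriod_pos hd) hlt
      ((hper _).1 (Function.isPeriodicPt_minimalPeriod _ _))
  rw [← h]
  exact ((hper n).2 hn).minimalPeriod_dvd

/-- The Frobenius period of an element bounds the degree of its minimal polynomial from below. -/
lemma le_natDegree_minpoly_of_frobenius_period {K : Type*} [Field K] [CharP K p]
    [Algebra (ZMod p) K] {x : K} {d : ℕ} (hd : 1 ≤ d) (hx : x ^ p ^ d = x)
    (hmin : ∀ e, 1 ≤ e → e < d → x ^ p ^ e ≠ x) : d ≤ (minpoly (ZMod p) x).natDegree := by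
  classical
  have hq : 2 ≤ p ^ d := (Fact.out : p.Prime).two_le.trans (Nat.le_self_pow (by omega) p)
  have hint : IsIntegral (ZMod p) x := ⟨X ^ p ^ d - X, monic_X_pow_sub (by
    rw [degree_X]; exact_mod_cast hq), by simp [hx]⟩
  have hinj : ∀ i < d, ∀ j < d, i ≤ j → x ^ p ^ i = x ^ p ^ j → i = j := by
    intro i hi j hj hij h
    have h1 : x ^ p ^ (j - i) = x := by
      refine iterateFrobenius_inj K p i ?_
      rw [iterateFrobenius_def, iterateFrobenius_def, ← pow_mul, ← pow_add, h]
      congr 2; omega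
    have := dvd_of_frobenius_period hd hx hmin h1
    have := Nat.eq_zero_of_dvd_of_lt this (by omega)
    omega
  have hcard : (Finset.range d).card ≤ ((minpoly (ZMod p) x).aroots K).toFinset.card := by
    refine Finset.card_le_card_of_injOn (fun i => x ^ p ^ i) (fun i _ => ?_) ?_
    · rw [Finset.mem_coe, Multiset.mem_toFinset, mem_aroots]
      refine ⟨minpoly.ne_zero hint, ?_⟩
      dsimp only
      rw [← iterateFrobenius_def, aeval_def,
        show algebraMap (ZMod p) K = (iterateFrobenius K p i).comp (algebraMap (ZMod p) K) from
          RingHom.ext_zmod _ _, ← hom_eval₂, ← aeval_def, minpoly.aeval, map_zero]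
    · intro i hi j hj h
      simp only [Finset.coe_range, Set.mem_Iio] at hi hj
      rcases le_total i j with hij | hij
      · exact hinj i hi j hj hij h
      · exact (hinj j hj i hi hij h.symm).symm
  rw [Finset.card_range] at hcard
  exact hcard.trans ((Multiset.toFinset_card_le _).trans ((card_roots' _).trans natDegree_map_le))

variable {k : Type} [Field k]

lemma fieldHasDeg_of_orderOf {x : k} {d : ℕ} (hd : 1 ≤ d) (hx : orderOf x = p ^ d - 1) :
    FieldHasDeg p d k := by
  have hp := (Fact.out : p.Prime)
  have key : ∀ m, 1 ≤ m → (x ^ p ^ m = x ↔ p ^ d - 1 ∣ p ^ m - 1) := by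
    intro m hm
    have hq : 2 ≤ p ^ m := hp.two_le.trans (Nat.le_self_pow (by omega) p)
    have hqd : 2 ≤ p ^ d := hp.two_le.trans (Nat.le_self_pow (by omega) p)
    have hx0 : x ≠ 0 := by
      rintro rfl
      rw [orderOf_zero] at hx
      omega
    rw [← hx, orderOf_dvd_iff_pow_eq_one]
    conv_lhs => rw [show p ^ m = p ^ m - 1 + 1 by omega, pow_succ]
    exact mul_eq_right₀ hx0
  refine ⟨x, (key d hd).2 dvd_rfl, fun e he hed h => ?_⟩
  have h1 := Nat.le_of_dvd (by
    have : 2 ≤ p ^ e := hp.two_le.trans (Nat.le_self_pow (by omega) p)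
    omega) ((key e he).1 h)
  have h2 : p ^ e < p ^ d := Nat.pow_lt_pow_right hp.one_lt hed
  have : 1 ≤ p ^ e := Nat.one_le_pow _ _ hp.pos
  omega

/-- Finitely many elements of an algebraic extension of `ZMod p` lie in a finite subfield, which
has elements of all degrees dividing its degree. -/
lemma exists_degree_of_finset [CharP k p] (halg : ∀ x : k, ∃ m : ℕ, 1 ≤ m ∧ x ^ p ^ m = x)
    (S : Finset k) : ∃ n, 1 ≤ n ∧ (∀ x ∈ S, x ^ p ^ n = x) ∧
      ∀ m, 1 ≤ m → m ∣ n → FieldHasDeg p m k := by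
  let _ : Algebra (ZMod p) k := ZMod.algebra k p
  have hp := (Fact.out : p.Prime)
  have hint : ∀ x ∈ (S : Set k), IsIntegral (ZMod p) x := by
    intro x _
    obtain ⟨m, hm, hx⟩ := halg x
    have hq : 2 ≤ p ^ m := hp.two_le.trans (Nat.le_self_pow (by omega) p)
    exact ⟨X ^ p ^ m - X, monic_X_pow_sub (by rw [degree_X]; exact_mod_cast hq), by simp [hx]⟩
  let L := IntermediateField.adjoin (ZMod p) (S : Set k)
  have : Finite (S : Set k) := S.finite_toSet
  have : FiniteDimensional (ZMod p) L := IntermediateField.finiteDimensional_adjoin hint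
  have : Finite L := Module.finite_of_finite (ZMod p)
  have : Fintype L := Fintype.ofFinite L
  have hcard : Nat.card L = p ^ Module.finrank (ZMod p) L := by
    rw [Module.natCard_eq_pow_finrank (K := ZMod p), Nat.card_zmod]
  set n := Module.finrank (ZMod p) L with hn
  have hn1 : 1 ≤ n := Module.finrank_pos
  refine ⟨n, hn1, fun x hx => ?_, fun m hm hmn => ?_⟩
  · have h := FiniteField.pow_card (⟨x, IntermediateField.subset_adjoin _ _ hx⟩ : L)
    rw [← Nat.card_eq_fintype_card, hcard] at h
    exact congrArg Subtype.val h
  · obtain ⟨g, hg⟩ := IsCyclic.exists_ofOrder_eq_natCard (α := Lˣ)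
    rw [Nat.card_units, hcard] at hg
    have hdvd : p ^ m - 1 ∣ p ^ n - 1 := Nat.pow_sub_one_dvd_pow_sub_one p hmn
    have hqn : 2 ≤ p ^ n := hp.two_le.trans (Nat.le_self_pow (by omega) p)
    obtain ⟨r, hr⟩ := hdvd
    have hr0 : r ≠ 0 := by rintro rfl; omega
    refine fieldHasDeg_of_orderOf (x := (((g ^ r : Lˣ) : L) : k)) hm ?_
    have h1 : orderOf (((g ^ r : Lˣ) : L) : k) = orderOf (g ^ r) := by
      exact (orderOf_injective (L.val : L →* k) L.val.injective ((g ^ r : Lˣ) : L)).trans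
        orderOf_units
    rw [h1, orderOf_pow_of_dvd hr0 ⟨p ^ m - 1, by rw [hg, hr, mul_comm]⟩, hg, hr]
    exact Nat.mul_div_cancel _ (Nat.pos_of_ne_zero hr0)

lemma fieldHasDeg_of_dvd [CharP k p] (halg : ∀ x : k, ∃ m : ℕ, 1 ≤ m ∧ x ^ p ^ m = x)
    {d m : ℕ} (hd : 1 ≤ d) (h : FieldHasDeg p d k) (hm : m ∣ d) : FieldHasDeg p m k := by
  obtain ⟨x, hx, hmin⟩ := h
  obtain ⟨n, -, hn, hdeg⟩ := exists_degree_of_finset halg {x}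
  exact hdeg m (Nat.pos_of_dvd_of_pos hm hd)
    (hm.trans (dvd_of_frobenius_period hd hx hmin (hn x (by simp))))

lemma exists_fieldHasDeg_dvd_dvd [CharP k p] (halg : ∀ x : k, ∃ m : ℕ, 1 ≤ m ∧ x ^ p ^ m = x)
    {d e : ℕ} (hd : 1 ≤ d) (he : 1 ≤ e) (h : FieldHasDeg p d k) (h' : FieldHasDeg p e k) :
    ∃ n, 1 ≤ n ∧ FieldHasDeg p n k ∧ d ∣ n ∧ e ∣ n := by
  classical
  obtain ⟨x, hx, hmin⟩ := h
  obtain ⟨y, hy, hmin'⟩ := h'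
  obtain ⟨n, hn1, hn, hdeg⟩ := exists_degree_of_finset halg {x, y}
  exact ⟨n, hn1, hdeg n hn1 dvd_rfl, dvd_of_frobenius_period hd hx hmin (hn x (by simp)),
    dvd_of_frobenius_period he hy hmin' (hn y (by simp))⟩

lemma exists_fieldHasDeg_gt [CharP k p] (halg : ∀ x : k, ∃ m : ℕ, 1 ≤ m ∧ x ^ p ^ m = x)
    [Infinite k] (N : ℕ) : ∃ d, N < d ∧ FieldHasDeg p d k := by
  classical
  by_contra! hcon
  have hp := (Fact.out : p.Prime)
  have hq : 1 < p ^ N.factorial := Nat.one_lt_pow (Nat.factorial_ne_zero _) hp.one_lt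
  have hne : (X ^ p ^ N.factorial - X : k[X]) ≠ 0 := FiniteField.X_pow_card_sub_X_ne_zero k hq
  refine Set.infinite_univ (α := k)
    ((X ^ p ^ N.factorial - X : k[X]).roots.toFinset.finite_toSet.subset ?_)
  intro x _
  have hex := halg x
  set d := Nat.find hex with hd
  obtain ⟨hd1, hdx⟩ := Nat.find_spec hex
  rw [← hd] at hd1 hdx
  have hdeg : FieldHasDeg p d k :=
    ⟨x, hdx, fun e he hed h => Nat.find_min hex hed ⟨he, h⟩⟩
  have hdN : d ∣ N.factorial :=
    Nat.dvd_factorial hd1 (not_lt.1 fun h => hcon d h hdeg)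
  have hx : x ^ p ^ N.factorial = x := by
    obtain ⟨r, hr⟩ := hdN
    rw [hr, pow_mul]
    clear hr
    induction r with
    | zero => simp
    | succ r ih => rw [pow_succ, pow_mul, ih, hdx]
  simp [hne, hx]

end FrobeniusPeriod

section ValueGroup

variable {Γ : AddSubgroup ℚ}

lemma one_div_den_mem (hZ : ∀ n : ℤ, (n : ℚ) ∈ Γ) {γ : ℚ} (hγ : γ ∈ Γ) :
    1 / (γ.den : ℚ) ∈ Γ := by
  have hd : (γ.den : ℚ) ≠ 0 := by exact_mod_cast γ.den_nz
  have hcop : IsCoprime γ.num (γ.den : ℤ) := by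
    rw [Int.isCoprime_iff_nat_coprime]
    exact γ.reduced
  obtain ⟨a, b, hab⟩ := hcop
  have hab' : (a : ℚ) * γ.num + b * γ.den = 1 := by exact_mod_cast hab
  have : 1 / (γ.den : ℚ) = a • γ + (b : ℚ) := by
    rw [zsmul_eq_mul]
    nth_rewrite 2 [← Rat.num_div_den γ]
    rw [div_eq_iff hd, ← hab', add_mul, mul_assoc, div_mul_cancel₀ _ hd]
  rw [this]
  exact add_mem (zsmul_mem hγ a) (hZ b)

lemma one_div_lcm_mem {d e : ℕ} (hd : 1 ≤ d) (he : 1 ≤ e) (hdΓ : 1 / (d : ℚ) ∈ Γ)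
    (heΓ : 1 / (e : ℚ) ∈ Γ) : 1 / ((d.lcm e : ℕ) : ℚ) ∈ Γ := by
  have hd0 : (d : ℚ) ≠ 0 := by exact_mod_cast (by omega : d ≠ 0)
  have he0 : (e : ℚ) ≠ 0 := by exact_mod_cast (by omega : e ≠ 0)
  have hl0 : ((d.lcm e : ℕ) : ℚ) ≠ 0 := by exact_mod_cast Nat.lcm_ne_zero (by omega) (by omega)
  have h1 : ((d.gcd e : ℕ) : ℚ) * (d.lcm e : ℕ) = d * e := by exact_mod_cast Nat.gcd_mul_lcm d e
  have h2 : ((d.gcd e : ℕ) : ℚ) = d * d.gcdA e + e * d.gcdB e := by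
    exact_mod_cast Nat.gcd_eq_gcd_ab d e
  have : 1 / ((d.lcm e : ℕ) : ℚ) = d.gcdA e • (1 / (e : ℚ)) + d.gcdB e • (1 / (d : ℚ)) := by
    rw [zsmul_eq_mul, zsmul_eq_mul]
    rw [h2] at h1
    field_simp
    linear_combination -h1
  rw [this]
  exact add_mem (zsmul_mem heΓ _) (zsmul_mem hdΓ _)

/-- Unbounded ramification provides arbitrarily large denominators. -/
lemma exists_one_div_mem_gt (hZ : ∀ n : ℤ, (n : ℚ) ∈ Γ)
    (h : ¬ ∃ e : ℕ, 0 < e ∧ ∀ γ ∈ Γ, ∃ k : ℤ, (e : ℚ) * γ = (k : ℚ)) (N : ℕ) :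
    ∃ e : ℕ, N < e ∧ 1 / (e : ℚ) ∈ Γ := by
  by_contra! hcon
  refine h ⟨N.factorial, N.factorial_pos, fun γ hγ => ?_⟩
  have hle : γ.den ≤ N := not_lt.1 fun hlt => hcon _ hlt (one_div_den_mem hZ hγ)
  obtain ⟨c, hc⟩ := Nat.dvd_factorial γ.pos hle
  refine ⟨c * γ.num, ?_⟩
  rw [hc]
  push_cast
  rw [mul_comm (γ.den : ℚ), mul_assoc, Rat.den_mul_eq_num]

end ValueGroup

section Core

open IntermediateField Topology

variable {p : ℕ} [Fact p.Prime] {C : Type*} [NormedField C] [NormedAlgebra ℚ_[p] C]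
  [IsUltrametricDist C]

lemma norm_pow_sub_self_lt_one_iff (x : unitBallRing C) (m : ℕ) :
    ‖(x : C) ^ m - x‖ < 1 ↔ normResidue x ^ m = normResidue x := by
  rw [← map_pow, normResidue_eq_iff]
  rfl

lemma norm_pow_sub_self_lt_one_congr {x y : C} (hx : ‖x‖ ≤ 1) (hxy : ‖y - x‖ < 1) {m : ℕ} :
    ‖x ^ m - x‖ < 1 ↔ ‖y ^ m - y‖ < 1 := by
  have hy : ‖y‖ ≤ 1 := by
    have := IsUltrametricDist.norm_add_le_max (y - x) x
    rw [sub_add_cancel] at this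
    exact this.trans (max_le hxy.le hx)
  have h : normResidue (⟨y, mem_unitBallRing.2 hy⟩ : unitBallRing C) =
    normResidue ⟨x, mem_unitBallRing.2 hx⟩ := normResidue_eq_iff.2 hxy
  have h1 := norm_pow_sub_self_lt_one_iff ⟨x, mem_unitBallRing.2 hx⟩ m
  have h2 := norm_pow_sub_self_lt_one_iff ⟨y, mem_unitBallRing.2 hy⟩ m
  rw [h] at h2
  exact h1.trans h2.symm

lemma norm_eq_of_norm_sub_lt_right {x y : C} (h : ‖x - y‖ < ‖y‖) : ‖x‖ = ‖y‖ := by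
  rw [sub_eq_add_neg] at h
  rw [← norm_neg y]
  exact IsUltrametricDist.norm_eq_of_add_norm_lt_max
    (h.trans_le (by rw [norm_neg]; exact le_max_right _ _))

/-- A primitive root of unity of order `p ^ d - 1` has residue of degree `d` over `ZMod p`. -/
lemma not_norm_pow_sub_self_lt_one {d e : ℕ} {ζ : C} (hζ : IsPrimitiveRoot ζ (p ^ d - 1))
    (he : 1 ≤ e) (hed : e < d) : ¬ ‖ζ ^ p ^ e - ζ‖ < 1 := by
  intro h
  have hp := (Fact.out : p.Prime)
  have h1 := eq_of_norm_sub_lt_one (p := p) (by omega : d ≠ 0)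
    (by rw [← pow_mul, mul_comm, pow_mul, hζ.pow_eq_one, one_pow]) hζ.pow_eq_one h
  have hqe : 2 ≤ p ^ e := hp.two_le.trans (Nat.le_self_pow (by omega) p)
  have hlt : p ^ e < p ^ d := Nat.pow_lt_pow_right hp.one_lt hed
  have h0 : ζ ≠ 0 := hζ.ne_zero (by omega)
  rw [show p ^ e = p ^ e - 1 + 1 by omega, pow_succ, mul_eq_right₀ h0] at h1
  have := Nat.le_of_dvd (by omega) (hζ.dvd_of_pow_eq_one _ h1)
  omega

/-- For every algebraic extension `k` of `ZMod p` and every value group `Γ`, not both finite over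
the base, some `α` generates over `ℚ_[p]` a field with residue field `k` and value group `Γ`. -/
theorem exists_transcendental_residue_value [CompleteSpace C]
    (ι : AlgebraicClosure ℚ_[p] →ₐ[ℚ_[p]] C) {k : Type} [Field k] [CharP k p]
    (halg : ∀ x : k, ∃ m : ℕ, 1 ≤ m ∧ x ^ p ^ m = x)
    {Γ : AddSubgroup ℚ} (hZΓ : ∀ n : ℤ, (n : ℚ) ∈ Γ)
    (hinf : Infinite k ∨ ¬ ∃ e : ℕ, 0 < e ∧ ∀ γ ∈ Γ, ∃ k : ℤ, (e : ℚ) * γ = (k : ℚ)) :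
    ∃ α : C, Transcendental ℚ_[p] α ∧
      (∀ γ ∈ Γ, ∃ x ∈ ℚ_[p]⟮α⟯, ‖x‖ = (p : ℝ) ^ (-γ : ℝ)) ∧
      (∀ x ∈ ℚ_[p]⟮α⟯, x ≠ 0 → ∃ γ ∈ Γ, ‖x‖ = (p : ℝ) ^ (-γ : ℝ)) ∧
      ∀ d, 1 ≤ d → (FieldHasDeg p d k ↔ ∃ x ∈ ℚ_[p]⟮α⟯, ‖x‖ ≤ 1 ∧ ‖x ^ p ^ d - x‖ < 1 ∧
        ∀ e, 1 ≤ e → e < d → ¬ ‖x ^ p ^ e - x‖ < 1) := by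
  have hp := (Fact.out : p.Prime)
  have hp0 : (0 : ℝ) < p := by exact_mod_cast hp.pos
  obtain ⟨K, T, hTc, hTK, hint, hK, hζ, hπ⟩ := exists_tower ι
    (P := fun d => FieldHasDeg p d k) (Q := fun e => 1 / (e : ℚ) ∈ Γ)
    ⟨0, by simp [hp.ne_zero], fun e he hed => by omega⟩ (by simpa using hZΓ 1)
    (fun d e hd he h h' => exists_fieldHasDeg_dvd_dvd halg hd he h h')
    (fun d e hd he h h' => ⟨d.lcm e, Nat.lcm_pos hd he, one_div_lcm_mem hd he h h',
      d.dvd_lcm_left e, d.dvd_lcm_right e⟩)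
  obtain ⟨α, hα, hT⟩ := exists_mem_closure_subset_closure_adjoin hint hTc hTK
  have happ : ∀ t ∈ T, ∀ ε > 0, ∃ x ∈ ℚ_[p]⟮α⟯, ‖x - t‖ < ε := fun t ht ε hε => by
    obtain ⟨x, hx, h⟩ := Metric.mem_closure_iff.1 (hT ht) ε hε
    exact ⟨x, hx, by rwa [← dist_eq_norm, dist_comm]⟩
  have happ' : ∀ x ∈ ℚ_[p]⟮α⟯, ∀ ε > 0, ∃ y ∈ K, ‖y - x‖ < ε := fun x hx ε hε => by
    have hle : ℚ_[p]⟮α⟯.toSubfield ≤ K.toSubfield.topologicalClosure := by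
      rw [adjoin_toSubfield, Subfield.closure_le]
      rintro z (⟨c, rfl⟩ | rfl)
      · exact subset_closure (K.algebraMap_mem c)
      · exact hα
    obtain ⟨y, hy, h⟩ := Metric.mem_closure_iff.1 (hle hx) ε hε
    exact ⟨y, hy, by rwa [← dist_eq_norm, dist_comm]⟩
  have hres : ∀ d, 1 ≤ d → FieldHasDeg p d k → ∃ x ∈ ℚ_[p]⟮α⟯, ‖x‖ ≤ 1 ∧
      ‖x ^ p ^ d - x‖ < 1 ∧ ∀ e, 1 ≤ e → e < d → ¬ ‖x ^ p ^ e - x‖ < 1 := fun d hd h => by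
    obtain ⟨ζ, hζT, hprim⟩ := hζ d hd h
    have hζ1 : ‖ζ‖ = 1 := norm_eq_one_of_pow_eq_one (p := p) (by omega) hprim.pow_eq_one
    obtain ⟨x, hx, hxζ⟩ := happ ζ hζT 1 one_pos
    refine ⟨x, hx, ?_, ?_, fun e he hed => ?_⟩
    · have := IsUltrametricDist.norm_add_le_max (x - ζ) ζ
      rw [sub_add_cancel] at this
      exact this.trans (max_le hxζ.le hζ1.le)
    · rw [← norm_pow_sub_self_lt_one_congr hζ1.le hxζ]
      have : 1 ≤ p ^ d := Nat.one_le_pow _ _ hp.pos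
      rw [show p ^ d = p ^ d - 1 + 1 by omega, pow_succ, hprim.pow_eq_one, one_mul, sub_self,
        norm_zero]
      exact one_pos
    · rw [← norm_pow_sub_self_lt_one_congr hζ1.le hxζ]
      exact not_norm_pow_sub_self_lt_one hprim he hed
  have hval : ∀ e : ℕ, 1 ≤ e → 1 / (e : ℚ) ∈ Γ → ∃ x ∈ ℚ_[p]⟮α⟯,
      ‖x‖ = (p : ℝ) ^ (-(1 / e) : ℝ) := fun e he h => by
    obtain ⟨π, hπT, hpow⟩ := hπ e he h
    have hn := norm_of_pow_eq_prime he hpow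
    have hpos : 0 < ‖π‖ := hn ▸ Real.rpow_pos_of_pos hp0 _
    obtain ⟨x, hx, hxπ⟩ := happ π hπT _ hpos
    exact ⟨x, hx, hn ▸ norm_eq_of_norm_sub_lt_right hxπ⟩
  refine ⟨α, fun halgα => ?_, fun γ hγ => ?_, fun x hx hx0 => ?_, fun d hd => ⟨hres d hd, ?_⟩⟩
  · have hα_int : IsIntegral ℚ_[p] α := halgα.isIntegral
    have : FiniteDimensional ℚ_[p] ℚ_[p]⟮α⟯ := adjoin.finiteDimensional hα_int
    have hdeg : ∀ x ∈ ℚ_[p]⟮α⟯, IsIntegral ℚ_[p] x ∧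
        (minpoly ℚ_[p] x).natDegree ≤ Module.finrank ℚ_[p] ℚ_[p]⟮α⟯ := fun x hx => by
      have h := IsIntegral.of_finite ℚ_[p] (⟨x, hx⟩ : ℚ_[p]⟮α⟯)
      refine ⟨isIntegral_iff.1 h, ?_⟩
      have := minpoly.natDegree_le (A := ℚ_[p]) (⟨x, hx⟩ : ℚ_[p]⟮α⟯)
      rwa [← minpoly.algHom_eq (ℚ_[p]⟮α⟯.val) Subtype.val_injective] at this
    rcases hinf with hk | hΓ
    · obtain ⟨d, hd, hdk⟩ := exists_fieldHasDeg_gt halg (Module.finrank ℚ_[p] ℚ_[p]⟮α⟯)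
      obtain ⟨x, hx, hx1, hxd, hmin⟩ := hres d (by omega) hdk
      let x' : unitBallRing C := ⟨x, mem_unitBallRing.2 hx1⟩
      have := normResidueField_charP p C
      have h1 := le_natDegree_minpoly_of_frobenius_period (p := p) (x := normResidue x') (d := d)
        (by omega) ((norm_pow_sub_self_lt_one_iff x' _).1 hxd)
        (fun e he hed h => hmin e he hed ((norm_pow_sub_self_lt_one_iff x' _).2 h))
      have h2 := natDegree_minpoly_residue_le (x := x') (hdeg x hx).1
      have h3 := (hdeg x hx).2
      have h4 := h1.trans (h2.trans h3)
      omega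
    · obtain ⟨e, he, heΓ⟩ := exists_one_div_mem_gt hZΓ hΓ (Module.finrank ℚ_[p] ℚ_[p]⟮α⟯)
      obtain ⟨x, hx, hxn⟩ := hval e (by omega) heΓ
      have h1 := le_natDegree_minpoly_of_norm hxn (hdeg x hx).1
      have h2 := (hdeg x hx).2
      omega
  · obtain ⟨x, hx, hxn⟩ := hval γ.den γ.pos (one_div_den_mem hZΓ hγ)
    refine ⟨x ^ γ.num, zpow_mem hx _, ?_⟩
    rw [norm_zpow, hxn, ← Real.rpow_intCast, ← Real.rpow_mul hp0.le]
    congr 1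
    nth_rewrite 3 [← Rat.num_div_den γ]
    push_cast
    ring
  · obtain ⟨y, hy, hyx⟩ := happ' x hx ‖x‖ (norm_pos_iff.2 hx0)
    have hn : ‖y‖ = ‖x‖ := norm_eq_of_norm_sub_lt_right hyx
    obtain ⟨d, e, hd, he, -, heΓ, h, -⟩ := hK y hy
    obtain ⟨n, h⟩ := h (norm_pos_iff.1 (hn ▸ norm_pos_iff.2 hx0))
    refine ⟨n • (1 / (e : ℚ)), zsmul_mem heΓ n, ?_⟩
    rw [← hn, h, zsmul_eq_mul]
    congr 1
    push_cast
    ring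
  · rintro ⟨x, hx, hx1, hxd, hmin⟩
    obtain ⟨y, hy, hyx⟩ := happ' x hx 1 one_pos
    obtain ⟨n, e, hn, he, hnk, -, -, h⟩ := hK y hy
    have hy1 : ‖y‖ ≤ 1 := by
      have := IsUltrametricDist.norm_add_le_max (y - x) x
      rw [sub_add_cancel] at this
      exact this.trans (max_le hyx.le hx1)
    have hxn := (norm_pow_sub_self_lt_one_congr hx1 hyx).2 (h hy1)
    let x' : unitBallRing C := ⟨x, mem_unitBallRing.2 hx1⟩
    have := normResidueField_charP p C
    refine fieldHasDeg_of_dvd halg hn hnk (dvd_of_frobenius_period (p := p) (x := normResidue x')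
      hd ((norm_pow_sub_self_lt_one_iff x' _).1 hxd)
      (fun e he hed h => hmin e he hed ((norm_pow_sub_self_lt_one_iff x' _).2 h))
      ((norm_pow_sub_self_lt_one_iff x' _).1 hxn))

end Core

section AddValNorm

variable {p : ℕ}

variable (p) in
/-- The exponential `γ ↦ p ^ (-γ)`, with `⊤` sent to `0`. -/
def negExp (a : WithTop ℚ) : ℝ :=
  WithTop.recTopCoe 0 (fun γ : ℚ => (p : ℝ) ^ (-γ : ℝ)) a

@[simp] lemma negExp_top : negExp p ⊤ = 0 := rfl

@[simp] lemma negExp_coe (γ : ℚ) : negExp p γ = (p : ℝ) ^ (-γ : ℝ) := rfl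

lemma negExp_zero : negExp p 0 = 1 := by
  rw [← WithTop.coe_zero, negExp_coe]; simp

variable [Fact p.Prime]

lemma prime_one_lt_real : (1 : ℝ) < p := by exact_mod_cast (Fact.out : p.Prime).one_lt

lemma negExp_strictAnti : StrictAnti (negExp p) := by
  have hp := prime_one_lt_real (p := p)
  intro a b hab
  induction a with
  | top => exact absurd hab not_top_lt
  | coe a =>
    induction b with
    | top => exact Real.rpow_pos_of_pos (by linarith) _
    | coe b =>
      rw [negExp_coe, negExp_coe, Real.rpow_lt_rpow_left_iff hp, neg_lt_neg_iff, Rat.cast_lt]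
      exact WithTop.coe_lt_coe.1 hab

lemma negExp_add (a b : WithTop ℚ) : negExp p (a + b) = negExp p a * negExp p b := by
  have hp := prime_one_lt_real (p := p)
  induction a with
  | top => simp
  | coe a =>
    induction b with
    | top => simp
    | coe b =>
      rw [← WithTop.coe_add, negExp_coe, negExp_coe, negExp_coe, ← Real.rpow_add (by linarith)]
      push_cast
      ring_nf

lemma negExp_nonneg (a : WithTop ℚ) : 0 ≤ negExp p a :=
  negExp_top (p := p) ▸ negExp_strictAnti.antitone le_top

lemma negExp_le_one_iff {a : WithTop ℚ} : negExp p a ≤ 1 ↔ 0 ≤ a := by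
  rw [← negExp_zero (p := p)]; exact negExp_strictAnti.le_iff_ge

lemma negExp_lt_one_iff {a : WithTop ℚ} : negExp p a < 1 ↔ 0 < a := by
  rw [← negExp_zero (p := p)]; exact negExp_strictAnti.lt_iff_gt

variable {K : Type} [Field K]

/-- The `p`-power absolute value attached to an additive valuation. -/
def AddVal.absVal (w : AddVal K) (p : ℕ) [Fact p.Prime] : AbsoluteValue K ℝ where
  toFun x := negExp p (w.v x)
  map_mul' x y := by rw [w.v_mul, negExp_add]
  nonneg' x := negExp_nonneg _
  eq_zero' x := by
    rw [← w.v_eq_top_iff, ← negExp_top (p := p), negExp_strictAnti.injective.eq_iff]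
  add_le' x y := by
    refine (negExp_strictAnti.antitone (w.min_le_v_add x y)).trans ?_
    rw [negExp_strictAnti.antitone.map_min]
    exact max_le_add_of_nonneg (negExp_nonneg _) (negExp_nonneg _)

lemma exists_rat_negExp_le {ε : ℝ} (hε : 0 < ε) : ∃ γ : ℚ, negExp p γ ≤ ε := by
  have hp := prime_one_lt_real (p := p)
  obtain ⟨n, hn⟩ := exists_pow_lt_of_lt_one hε (inv_lt_one_of_one_lt₀ hp)
  refine ⟨n, hn.le.trans' ?_⟩
  rw [negExp_coe, Rat.cast_natCast, Real.rpow_neg (by linarith), Real.rpow_natCast, inv_pow]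

end AddValNorm

namespace CpSetup

variable {p : ℕ} [Fact p.Prime] (S : CpSetup p)

/-- The normed field structure on a model of `ℂ_p`. -/
abbrev normedField : NormedField S.Cp := (S.vC.absVal p).toNormedField

lemma vC_qpHomC (x : ℚ_[p]) : negExp p (S.vC.v (qpHomC p S x)) = ‖x‖ := by
  by_cases hx : x = 0
  · subst hx
    rw [map_zero, (S.vC.v_eq_top_iff 0).2 rfl, negExp_top, norm_zero]
  · rw [qpHomC, RingHom.comp_apply, S.vC_emb, S.vbar_extends x hx, negExp_coe,
      Padic.norm_eq_zpow_neg_valuation hx, ← Real.rpow_intCast]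
    push_cast
    rfl

/-- The normed algebra structure on a model of `ℂ_p`. -/
abbrev normedAlgebra : let _ := S.normedField
    NormedAlgebra ℚ_[p] S.Cp :=
  let _ := S.normedField
  { (qpHomC p S).toAlgebra with
    norm_smul_le := fun r x => by
      change ‖qpHomC p S r * x‖ ≤ _
      rw [norm_mul]
      exact mul_le_mul_of_nonneg_right (S.vC_qpHomC r).le (norm_nonneg _) }

lemma isUltrametricDist :
    @IsUltrametricDist S.Cp (S.normedField.toMetricSpace.toPseudoMetricSpace.toDist) := by
  let _ := S.normedField
  refine IsUltrametricDist.isUltrametricDist_of_forall_norm_add_le_max_norm fun x y => ?_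
  change negExp p _ ≤ max (negExp p _) (negExp p _)
  rw [← negExp_strictAnti.antitone.map_min]
  exact negExp_strictAnti.antitone (S.vC.min_le_v_add x y)

lemma completeSpace :
    @CompleteSpace S.Cp (S.normedField.toMetricSpace.toPseudoMetricSpace.toUniformSpace) := by
  let _ := S.normedField
  have hp := prime_one_lt_real (p := p)
  refine Metric.complete_of_cauchySeq_tendsto fun u hu => ?_
  have hc : S.vC.IsCauchySeq u := fun γ => by
    obtain ⟨N, hN⟩ := Metric.cauchySeq_iff.1 hu (negExp p γ) (Real.rpow_pos_of_pos (by linarith) _)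
    refine ⟨N, fun m hm n hn => negExp_strictAnti.lt_iff_gt.1 (?_ : negExp p _ < _)⟩
    have := hN m hm n hn
    rwa [dist_eq_norm] at this
  obtain ⟨l, hl⟩ := S.complete u hc
  refine ⟨l, Metric.tendsto_atTop.2 fun ε hε => ?_⟩
  obtain ⟨γ, hγ⟩ := exists_rat_negExp_le (p := p) hε
  obtain ⟨N, hN⟩ := hl γ
  refine ⟨N, fun n hn => ?_⟩
  rw [dist_eq_norm]
  exact (negExp_strictAnti (hN n hn)).trans_le hγ

variable {S} {α : S.Cp}

lemma eval_div_of_isTranscOver (hα : IsTranscOver (qpHomC p S) α) (f g : ℚ_[p][X])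
    (hg : g ≠ 0) :
    RatFunc.eval (qpHomC p S) α (algebraMap ℚ_[p][X] (RatFunc ℚ_[p]) f / algebraMap _ _ g) =
      f.eval₂ (qpHomC p S) α / g.eval₂ (qpHomC p S) α := by
  set φ := algebraMap ℚ_[p][X] (RatFunc ℚ_[p]) f / algebraMap _ _ g with hφ
  have h := (RatFunc.num_mul_eq_mul_denom_iff hg).2 hφ
  have h' := congrArg (Polynomial.eval₂ (qpHomC p S) α) h
  rw [Polynomial.eval₂_mul, Polynomial.eval₂_mul] at h'
  rw [RatFunc.eval, div_eq_div_iff (hα _ φ.denom_ne_zero) (hα _ hg), h']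

lemma inQpAlpha_iff_exists_eval (hα : IsTranscOver (qpHomC p S) α) {x : S.Cp} :
    InQpAlpha p S α x ↔ ∃ φ : RatFunc ℚ_[p], RatFunc.eval (qpHomC p S) α φ = x := by
  constructor
  · rintro ⟨f, g, hg, rfl⟩
    exact ⟨_, eval_div_of_isTranscOver hα f g (by rintro rfl; simp at hg)⟩
  · rintro ⟨φ, rfl⟩
    exact ⟨φ.num, φ.denom, hα _ φ.denom_ne_zero, rfl⟩

lemma resHasDegCp_iff_zpaResHasDeg (hα : IsTranscOver (qpHomC p S) α) (d : ℕ) :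
    ResHasDegCp p S α d ↔ ZpaResHasDeg p S α d := by
  constructor
  · rintro ⟨x, hx, h0, h⟩
    obtain ⟨φ, rfl⟩ := (inQpAlpha_iff_exists_eval hα).1 hx
    exact ⟨φ, ⟨hα _ φ.denom_ne_zero, h0⟩, h⟩
  · rintro ⟨φ, ⟨-, h0⟩, h⟩
    exact ⟨_, (inQpAlpha_iff_exists_eval hα).2 ⟨φ, rfl⟩, h0, h⟩

variable (S) in
lemma exists_isTranscOver {k : Type} [Field k] [CharP k p]
    (halg : ∀ x : k, ∃ m : ℕ, 1 ≤ m ∧ x ^ p ^ m = x) {Γ : AddSubgroup ℚ}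
    (hZΓ : ∀ n : ℤ, (n : ℚ) ∈ Γ) (hinf : Infinite k ∨ ¬ HasFiniteRamification (Γ : Set ℚ)) :
    ∃ α : S.Cp, IsTranscOver (qpHomC p S) α ∧ valSetCp p S α = (Γ : Set ℚ) ∧
      ∀ d : ℕ, 1 ≤ d → (FieldHasDeg p d k ↔ ResHasDegCp p S α d) := by
  let _ := S.normedField
  let _ := S.normedAlgebra
  have := S.isUltrametricDist
  have := S.completeSpace
  have hp := prime_one_lt_real (p := p)
  let ι : AlgebraicClosure ℚ_[p] →ₐ[ℚ_[p]] S.Cp := { S.emb with commutes' := fun _ => rfl }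
  obtain ⟨α, hα, hΓ, hΓ', hdeg⟩ := exists_transcendental_residue_value ι halg hZΓ hinf
  have hT : IsTranscOver (qpHomC p S) α := fun f hf h => hα ⟨f, hf, h⟩
  have hmem : ∀ x, InQpAlpha p S α x ↔ x ∈ IntermediateField.adjoin ℚ_[p] {α} := fun x => by
    rw [IntermediateField.mem_adjoin_simple_iff]
    constructor
    · rintro ⟨f, g, -, rfl⟩
      exact ⟨f, g, rfl⟩
    · rintro ⟨f, g, rfl⟩
      by_cases hg : g = 0
      · exact ⟨0, 1, by simp, by simp [hg]⟩
      · exact ⟨f, g, hT g hg, rfl⟩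
  have hn : ∀ x : S.Cp, ‖x‖ = negExp p (S.vC.v x) := fun _ => rfl
  refine ⟨α, hT, Set.ext fun γ => ⟨?_, fun h => ?_⟩, fun d hd => (hdeg d hd).trans ?_⟩
  · rintro ⟨x, hx, hxγ⟩
    have hx0 : x ≠ 0 := by
      rintro rfl
      rw [(S.vC.v_eq_top_iff 0).2 rfl] at hxγ
      exact WithTop.top_ne_coe hxγ
    obtain ⟨δ, hδ, h⟩ := hΓ' x ((hmem x).1 hx) hx0
    rw [hn, hxγ, ← negExp_coe, negExp_strictAnti.injective.eq_iff, WithTop.coe_inj] at h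
    exact h ▸ hδ
  · obtain ⟨x, hx, h⟩ := hΓ γ h
    rw [hn, ← negExp_coe, negExp_strictAnti.injective.eq_iff] at h
    exact ⟨x, (hmem x).2 hx, h⟩
  · simp only [ResHasDegCp, hmem, hn, negExp_le_one_iff, negExp_lt_one_iff]

end CpSetup

/-- Let `k` be an algebraic extension of `𝔽_p` and `Γ` a group with
`ℤ ⊆ Γ ⊆ ℚ`, such that `[k:𝔽_p]` is infinite or `[Γ:ℤ]` is infinite.  Then there exists a
transcendental `α ∈ ℂ_p` such that `k_α ≅ k` and `Γ_α = Γ`; consequently the valuation ring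
`ℤ_{p,α}` of `ℚ_p(X)` has residue field `k` and value group `Γ`. -/
theorem stmt_12 (p : ℕ) [Fact p.Prime] (S : CpSetup p)
    (k : Type) [Field k] (hchar : (p : k) = 0)
    (halg : ∀ x : k, ∃ m : ℕ, 1 ≤ m ∧ x ^ p ^ m = x)
    (Γ : AddSubgroup ℚ) (hZΓ : ∀ n : ℤ, (n : ℚ) ∈ Γ)
    (hinf : Infinite k ∨ ¬ HasFiniteRamification (Γ : Set ℚ)) :
    ∃ α : S.Cp, IsTranscOver (qpHomC p S) α ∧
      -- `Γ_α = Γ`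
      valSetCp p S α = (Γ : Set ℚ) ∧
      -- `k_α ≅ k`
      (∀ d : ℕ, 1 ≤ d → (FieldHasDeg p d k ↔ ResHasDegCp p S α d)) ∧
      -- the value group of `ℤ_{p,α}` is `Γ`
      ({γ : ℚ | ∃ φ : RatFunc ℚ_[p],
          S.vC.v (RatFunc.eval (qpHomC p S) α φ) = (γ : WithTop ℚ)} = (Γ : Set ℚ)) ∧
      -- the residue field of `ℤ_{p,α}` is (isomorphic to) `k`
      (∀ d : ℕ, 1 ≤ d → (FieldHasDeg p d k ↔ ZpaResHasDeg p S α d)) := by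
  have : CharP k p := (CharP.charP_iff_prime_eq_zero Fact.out).2 hchar
  obtain ⟨α, hα, hval, hres⟩ := S.exists_isTranscOver halg hZΓ hinf
  refine ⟨α, hα, hval, hres, ?_, fun d hd =>
    (hres d hd).trans (CpSetup.resHasDegCp_iff_zpaResHasDeg hα d)⟩
  rw [← hval]
  ext γ
  simp [valSetCp, CpSetup.inQpAlpha_iff_exists_eval hα]

end
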